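/- Let A : X₊ → X₊ be the solution operator assigning to each v ∈ X₊ the unique viscosity solution u ∈ X of F(D²u) − (1/2) y·Du = v in ℝⁿ. Then A is continuous with respect to the norm ‖·‖_X, and A is compact: for every bounded subset B of X₊, the closure of {A(v) : v ∈ B} is compact in X. -/

import Mathlib

noncomputable section

open Filter Matrix Real Set
open scoped Topology

/-- Euclidean `n`-space `ℝⁿ`. -/
abbrev En (n : ℕ) := EuclideanSpace ℝ (Fin n)

/-- `n × n` real matrices. -/
abbrev Mat (n : ℕ) := Matrix (Fin n) (Fin n) ℝ

/-- The set of symmetric positive definite matrices whose eigenvalues all lie in `[lam, Lam]`. -/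
def PucciMatrices (n : ℕ) (lam Lam : ℝ) : Set (Mat n) :=
  { A | ∃ hA : A.IsHermitian, ∀ i, hA.eigenvalues i ∈ Set.Icc lam Lam }

/-- The Pucci maximal operator `P⁺(M) = sup {-tr(AM) : A ∈ PucciMatrices}`. -/
def PucciPlus (n : ℕ) (lam Lam : ℝ) (M : Mat n) : ℝ :=
  sSup ((fun A => -(A * M).trace) '' PucciMatrices n lam Lam)

/-- The Pucci minimal operator `P⁻(M) = inf {-tr(AM) : A ∈ PucciMatrices}`. -/
def PucciMinus (n : ℕ) (lam Lam : ℝ) (M : Mat n) : ℝ :=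
  sInf ((fun A => -(A * M).trace) '' PucciMatrices n lam Lam)

/-- `F` is uniformly elliptic with ellipticity constants `lam ≤ Lam`. -/
def UniformlyElliptic (n : ℕ) (lam Lam : ℝ) (F : Mat n → ℝ) : Prop :=
  ∀ M N : Mat n, M.IsSymm → N.IsSymm →
    PucciMinus n lam Lam (M - N) ≤ F M - F N ∧ F M - F N ≤ PucciPlus n lam Lam (M - N)

/-- `F` is positively homogeneous of order one. -/
def PositivelyHomogeneous (n : ℕ) (F : Mat n → ℝ) : Prop :=
  ∀ (M : Mat n), ∀ η : ℝ, 0 ≤ η → F (η • M) = η * F M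

/-- The Hessian matrix of `φ : ℝⁿ → ℝ` at a point `y`. -/
def hess (n : ℕ) (φ : En n → ℝ) (y : En n) : Mat n :=
  Matrix.of fun i j =>
    fderiv ℝ (fun z => fderiv ℝ φ z (EuclideanSpace.single j 1)) y (EuclideanSpace.single i 1)

/-- Viscosity subsolution of the elliptic equation `G(D²u, Du, u, y) = 0` on `Ω`,
i.e. `G[u] ≤ 0` in the viscosity sense. -/
def ViscSubE (n : ℕ) (Ω : Set (En n))
    (G : Mat n → (En n →L[ℝ] ℝ) → ℝ → En n → ℝ) (u : En n → ℝ) : Prop :=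
  ∀ y ∈ Ω, ∀ φ : En n → ℝ, ContDiff ℝ 2 φ →
    IsLocalMaxOn (fun z => u z - φ z) Ω y →
    G (hess n φ y) (fderiv ℝ φ y) (u y) y ≤ 0

/-- Viscosity supersolution of the elliptic equation `G(D²u, Du, u, y) = 0` on `Ω`,
i.e. `G[u] ≥ 0` in the viscosity sense. -/
def ViscSupE (n : ℕ) (Ω : Set (En n))
    (G : Mat n → (En n →L[ℝ] ℝ) → ℝ → En n → ℝ) (u : En n → ℝ) : Prop :=
  ∀ y ∈ Ω, ∀ φ : En n → ℝ, ContDiff ℝ 2 φ →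
    IsLocalMinOn (fun z => u z - φ z) Ω y →
    0 ≤ G (hess n φ y) (fderiv ℝ φ y) (u y) y

/-- Viscosity solution of the elliptic equation `G(D²u, Du, u, y) = 0` on `Ω`. -/
def ViscSolE (n : ℕ) (Ω : Set (En n))
    (G : Mat n → (En n →L[ℝ] ℝ) → ℝ → En n → ℝ) (u : En n → ℝ) : Prop :=
  ViscSubE n Ω G u ∧ ViscSupE n Ω G u

/-- Time derivative of `φ : ℝⁿ × ℝ → ℝ` at `p = (x, t)`. -/
def tderiv (n : ℕ) (φ : En n × ℝ → ℝ) (p : En n × ℝ) : ℝ :=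
  deriv (fun s => φ (p.1, s)) p.2

/-- Spatial Hessian of `φ : ℝⁿ × ℝ → ℝ` at `p = (x, t)`. -/
def shess (n : ℕ) (φ : En n × ℝ → ℝ) (p : En n × ℝ) : Mat n :=
  hess n (fun z => φ (z, p.2)) p.1

/-- Spatial differential of `φ : ℝⁿ × ℝ → ℝ` at `p = (x, t)`. -/
def sgrad (n : ℕ) (φ : En n × ℝ → ℝ) (p : En n × ℝ) : En n →L[ℝ] ℝ :=
  fderiv ℝ (fun z => φ (z, p.2)) p.1

/-- Viscosity subsolution of the parabolic equation `u_t + G(D²u, Du, u, (x,t)) = 0` on `Ω`. -/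
def ViscSubP (n : ℕ) (Ω : Set (En n × ℝ))
    (G : Mat n → (En n →L[ℝ] ℝ) → ℝ → En n × ℝ → ℝ) (u : En n × ℝ → ℝ) : Prop :=
  ∀ p ∈ Ω, ∀ φ : En n × ℝ → ℝ, ContDiff ℝ 2 φ →
    IsLocalMaxOn (fun q => u q - φ q) Ω p →
    tderiv n φ p + G (shess n φ p) (sgrad n φ p) (u p) p ≤ 0

/-- Viscosity supersolution of the parabolic equation `u_t + G(D²u, Du, u, (x,t)) = 0` on `Ω`. -/
def ViscSupP (n : ℕ) (Ω : Set (En n × ℝ))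
    (G : Mat n → (En n →L[ℝ] ℝ) → ℝ → En n × ℝ → ℝ) (u : En n × ℝ → ℝ) : Prop :=
  ∀ p ∈ Ω, ∀ φ : En n × ℝ → ℝ, ContDiff ℝ 2 φ →
    IsLocalMinOn (fun q => u q - φ q) Ω p →
    0 ≤ tderiv n φ p + G (shess n φ p) (sgrad n φ p) (u p) p

/-- Viscosity solution of the parabolic equation `u_t + G(D²u, Du, u, (x,t)) = 0` on `Ω`. -/
def ViscSolP (n : ℕ) (Ω : Set (En n × ℝ))
    (G : Mat n → (En n →L[ℝ] ℝ) → ℝ → En n × ℝ → ℝ) (u : En n × ℝ → ℝ) : Prop :=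
  ViscSubP n Ω G u ∧ ViscSupP n Ω G u

/-- The parabolic domain `ℝⁿ × ℝ₊`. -/
def Qset (n : ℕ) : Set (En n × ℝ) := {p | 0 < p.2}

/-- The elliptic operator `F(D²u) - (1/2) y·Du - α u - f(y)`. -/
def Fop (n : ℕ) (F : Mat n → ℝ) (α : ℝ) (f : En n → ℝ) :
    Mat n → (En n →L[ℝ] ℝ) → ℝ → En n → ℝ :=
  fun M p v y => F M - (1/2) * p y - α * v - f y

/-- Membership in the space `X` with weight `b`: continuity and finiteness of the norm. -/
def memX (n : ℕ) (b : ℝ) (u : En n → ℝ) : Prop :=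
  Continuous u ∧ BddAbove (Set.range fun y : En n => |u y| * Real.exp (b * ‖y‖ ^ 2) / (1 + ‖y‖ ^ 2))

/-- The norm `‖u‖_X = sup_y |u(y)| e^{b|y|²} / (1 + |y|²)`. -/
def normX (n : ℕ) (b : ℝ) (u : En n → ℝ) : ℝ :=
  sSup (Set.range fun y : En n => |u y| * Real.exp (b * ‖y‖ ^ 2) / (1 + ‖y‖ ^ 2))

/-- The positive anomalous exponent `α⁺(F)`. -/
def alphaPlus (n : ℕ) (lam Lam : ℝ) (F : Mat n → ℝ) : ℝ :=
  sSup { α : ℝ | ∃ φ : En n → ℝ, memX n (1/(8*Lam)) φ ∧ (∀ y, 0 ≤ φ y) ∧ φ ≠ 0 ∧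
    ViscSupE n Set.univ (Fop n F α (fun _ => 0)) φ }

/-- `Φ` is a positive self-similar solution of `u_t + F(D²u) = 0` with exponent `α`,
with a Gaussian upper bound at time one. -/
def IsSelfSimilarPlus (n : ℕ) (F : Mat n → ℝ) (α : ℝ) (Φ : En n × ℝ → ℝ) : Prop :=
  ContinuousOn Φ (Qset n) ∧
  (∀ p ∈ Qset n, 0 < Φ p) ∧
  ViscSolP n (Qset n) (fun M _ _ _ => F M) Φ ∧
  (∀ σ : ℝ, 0 < σ → ∀ x : En n, ∀ t : ℝ, 0 < t →
    Φ (x, t) = σ ^ α * Φ (Real.sqrt σ • x, σ * t)) ∧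
  (∃ C : ℝ, 0 < C ∧ ∃ a : ℝ, 0 < a ∧ ∀ x : En n, Φ (x, 1) ≤ C * Real.exp (-a * ‖x‖ ^ 2))

/-- `Φ` is a negative self-similar solution of `u_t + F(D²u) = 0` with exponent `α`,
with a Gaussian lower bound at time one. -/
def IsSelfSimilarMinus (n : ℕ) (F : Mat n → ℝ) (α : ℝ) (Φ : En n × ℝ → ℝ) : Prop :=
  ContinuousOn Φ (Qset n) ∧
  (∀ p ∈ Qset n, Φ p < 0) ∧
  ViscSolP n (Qset n) (fun M _ _ _ => F M) Φ ∧
  (∀ σ : ℝ, 0 < σ → ∀ x : En n, ∀ t : ℝ, 0 < t →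
    Φ (x, t) = σ ^ α * Φ (Real.sqrt σ • x, σ * t)) ∧
  (∃ C : ℝ, 0 < C ∧ ∃ a : ℝ, 0 < a ∧ ∀ x : En n, -Φ (x, 1) ≤ C * Real.exp (-a * ‖x‖ ^ 2))

/-- The set `S` of locally uniform sequential limits of the rescalings
`u^σ(x,t) = σ^α u(σ^{1/2} x, σ t)` as `σ → ∞`. -/
def limitSet (n : ℕ) (α : ℝ) (u : En n × ℝ → ℝ) : Set (En n × ℝ → ℝ) :=
  { U | ContinuousOn U (Qset n) ∧ ∃ σ : ℕ → ℝ,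
      Tendsto σ atTop atTop ∧
      TendstoLocallyUniformlyOn
        (fun k (p : En n × ℝ) => (σ k) ^ α * u (Real.sqrt (σ k) • p.1, σ k * p.2))
        U atTop (Qset n) }

section Aleksandrov

variable {H : Type*} [NormedAddCommGroup H] [InnerProductSpace ℝ H]

theorem abs_sub_le_of_linear_add_quadratic {g : ℝ → ℝ} {c K : ℝ}
    (hg : ∀ s t, 0 ≤ s → s ≤ t → t ≤ 1 → |g t - g s| ≤ c * (t - s) + K * (t - s) ^ 2) :
    |g 1 - g 0| ≤ c := by
  have key : ∀ N : ℕ, |g 1 - g 0| ≤ c + K * (1 / ((N : ℝ) + 1)) := by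
    intro N
    have hN : (0 : ℝ) < (N : ℝ) + 1 := by positivity
    have step : ∀ i : ℕ, i ≤ N + 1 → |g (i / ((N : ℝ) + 1)) - g 0| ≤
        i * (c * (1 / ((N : ℝ) + 1)) + K * (1 / ((N : ℝ) + 1)) ^ 2) := by
      intro i
      induction i with
      | zero => intro _; simp
      | succ i ih =>
        intro hi
        have h1 := ih (by omega)
        have hi' : ((i : ℝ) + 1) ≤ (N : ℝ) + 1 := by exact_mod_cast hi
        have h2 := hg (i / ((N : ℝ) + 1)) ((i + 1) / ((N : ℝ) + 1)) (by positivity)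
          (by gcongr; linarith) (by rw [div_le_one hN]; exact hi')
        have h3 : ((i : ℝ) + 1) / ((N : ℝ) + 1) - i / ((N : ℝ) + 1) = 1 / ((N : ℝ) + 1) := by
          ring
        rw [h3] at h2
        push_cast
        have h4 := abs_sub_le (g (((i : ℝ) + 1) / ((N : ℝ) + 1))) (g (i / ((N : ℝ) + 1))) (g 0)
        linarith
    have h := step (N + 1) le_rfl
    push_cast at h
    rw [div_self hN.ne'] at h
    refine h.trans (le_of_eq ?_)
    field_simp
  have hlim : Tendsto (fun N : ℕ => c + K * (1 / ((N : ℝ) + 1))) atTop (𝓝 (c + K * 0)) :=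
    (tendsto_one_div_add_atTop_nhds_zero_nat.const_mul K).const_add c
  simpa using ge_of_tendsto' hlim key

/-- A function with a selection of subgradients which is differentiable at `x` has a second order
expansion at `x`. -/
theorem second_order_expansion_of_subgradient {f : H → ℝ} {q : H → H}
    (hq : ∀ x x', f x + inner ℝ (q x) (x' - x) ≤ f x') {x : H} {B : H →L[ℝ] H}
    (hB : (fun h => q (x + h) - q x - B h) =o[𝓝 0] (fun h : H => h)) {ε : ℝ} (hε : 0 < ε) :
    ∀ᶠ h in 𝓝 (0 : H),
      |f (x + h) - f x - inner ℝ (q x) h - 1 / 2 * inner ℝ (B h) h| ≤ ε * ‖h‖ ^ 2 := by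
  obtain ⟨δ, hδ, hball⟩ := Metric.eventually_nhds_iff.1 (hB.def hε)
  refine Metric.eventually_nhds_iff.2 ⟨δ, hδ, fun h hh => ?_⟩
  rw [dist_zero_right] at hh
  have hqt : ∀ t : ℝ, 0 ≤ t → t ≤ 1 →
      |inner ℝ (q (x + t • h)) h - inner ℝ (q x) h - t * inner ℝ (B h) h| ≤ ε * ‖h‖ ^ 2 := by
    intro t ht0 ht1
    have hth : ‖t • h‖ ≤ ‖h‖ := by
      rw [norm_smul, Real.norm_of_nonneg ht0]
      exact mul_le_of_le_one_left (norm_nonneg _) ht1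
    have h1 : ‖q (x + t • h) - q x - B (t • h)‖ ≤ ε * ‖t • h‖ :=
      hball (by rw [dist_zero_right]; exact hth.trans_lt hh)
    have h2 : inner ℝ (q (x + t • h)) h - inner ℝ (q x) h - t * inner ℝ (B h) h =
        inner ℝ (q (x + t • h) - q x - B (t • h)) h := by
      rw [inner_sub_left, inner_sub_left, map_smul, inner_smul_left]; simp
    rw [h2]
    calc |inner ℝ (q (x + t • h) - q x - B (t • h)) h|
        ≤ ‖q (x + t • h) - q x - B (t • h)‖ * ‖h‖ := abs_real_inner_le_norm _ _
      _ ≤ ε * ‖h‖ * ‖h‖ := by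
          gcongr
          exact h1.trans (by gcongr)
      _ = ε * ‖h‖ ^ 2 := by ring
  have := abs_sub_le_of_linear_add_quadratic
    (g := fun t => f (x + t • h) - t * inner ℝ (q x) h - t ^ 2 / 2 * inner ℝ (B h) h)
    (c := ε * ‖h‖ ^ 2) (K := |inner ℝ (B h) h| / 2) (by
      intro s t hs hst ht
      have a1 := hqt s hs (hst.trans ht)
      have a2 := hqt t (hs.trans hst) ht
      have b1 := hq (x + s • h) (x + t • h)
      have b2 := hq (x + t • h) (x + s • h)
      have e1 : x + t • h - (x + s • h) = (t - s) • h := by rw [sub_smul]; abel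
      have e2 : x + s • h - (x + t • h) = -((t - s) • h) := by rw [sub_smul]; abel
      rw [e1, inner_smul_right] at b1
      rw [e2, inner_neg_right, inner_smul_right] at b2
      have hβ := neg_abs_le (inner ℝ (B h) h)
      have hβ' := le_abs_self (inner ℝ (B h) h)
      rw [abs_le] at a1 a2 ⊢
      have hts : 0 ≤ t - s := by linarith
      generalize inner ℝ (B h) h = β at *
      generalize |β| = β' at *
      generalize inner ℝ (q (x + t • h)) h = qt at *
      generalize inner ℝ (q (x + s • h)) h = qs at *
      generalize inner ℝ (q x) h = q0 at *
      have c1 := mul_le_mul_of_nonneg_left a1.1 hts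
      have c2 := mul_le_mul_of_nonneg_left a2.2 hts
      have c3 := mul_le_mul_of_nonneg_left hβ (sq_nonneg (t - s))
      have c4 := mul_le_mul_of_nonneg_left hβ' (sq_nonneg (t - s))
      constructor <;> nlinarith)
  simp only [one_smul, zero_smul, add_zero] at this
  convert this using 2
  ring

theorem exists_expansion_of_leftInverse [FiniteDimensional ℝ H] {Y J : H → H}
    (hJ : ∀ x, J (Y x) = x) {x : H} (hd : DifferentiableWithinAt ℝ J (range Y) (Y x)) {L : ℝ}
    (hL : ∀ x', ‖Y x' - Y x‖ ≤ L * ‖x' - x‖) :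
    ∃ B : H →L[ℝ] H, (fun h => Y (x + h) - Y x - B h) =o[𝓝 0] (fun h : H => h) := by
  obtain ⟨J', hJ'⟩ := hd
  have hbig : (fun h => Y (x + h) - Y x) =O[𝓝 0] (fun h : H => h) :=
    Asymptotics.IsBigO.of_bound L (Eventually.of_forall fun h => by simpa using hL (x + h))
  have htend : Tendsto (fun h => Y (x + h)) (𝓝 0) (𝓝[range Y] (Y x)) := by
    refine tendsto_nhdsWithin_iff.2 ⟨?_, Eventually.of_forall fun h => mem_range_self _⟩
    have : Tendsto (fun h => Y (x + h) - Y x) (𝓝 0) (𝓝 0) := hbig.trans_tendsto tendsto_id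
    simpa using this.add_const (Y x)
  have h1 : (fun h => h - J' (Y (x + h) - Y x)) =o[𝓝 0] (fun h : H => h) := by
    have h2 := (hJ'.isLittleO.comp_tendsto htend).trans_isBigO hbig
    refine h2.congr_left fun h => ?_
    simp [hJ]
  have hsurj : Function.Surjective J' := by
    intro h
    have hcl : IsClosed (LinearMap.range (J' : H →ₗ[ℝ] H) : Set H) :=
      Submodule.closed_of_finiteDimensional _
    have ht : Tendsto (fun t : ℝ => t • h) (𝓝[≠] 0) (𝓝 0) := by
      have : Tendsto (fun t : ℝ => t • h) (𝓝 0) (𝓝 ((0 : ℝ) • h)) :=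
        tendsto_id.smul_const h
      rw [zero_smul] at this
      exact this.mono_left nhdsWithin_le_nhds
    have h3 : (fun t : ℝ => t • h - J' (Y (x + t • h) - Y x)) =o[𝓝[≠] 0] (fun t : ℝ => t) := by
      have h4 : (fun t : ℝ => t • h) =O[𝓝[≠] 0] (fun t : ℝ => t) :=
        Asymptotics.IsBigO.of_bound ‖h‖ (Eventually.of_forall fun t => by
          rw [norm_smul, mul_comm])
      exact (h1.comp_tendsto ht).trans_isBigO h4
    have h5 : Tendsto (fun t : ℝ => t⁻¹ • (t • h - J' (Y (x + t • h) - Y x))) (𝓝[≠] 0) (𝓝 0) :=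
      h3.tendsto_inv_smul_nhds_zero
    have h6 : Tendsto (fun t : ℝ => J' (t⁻¹ • (Y (x + t • h) - Y x))) (𝓝[≠] 0) (𝓝 h) := by
      have h7 := (tendsto_const_nhds (x := h)).sub h5
      rw [sub_zero] at h7
      refine h7.congr' ?_
      filter_upwards [self_mem_nhdsWithin] with t ht
      have ht' : t ≠ 0 := ht
      rw [smul_sub, smul_smul, inv_mul_cancel₀ ht', one_smul, sub_sub_cancel, map_smul]
    have := hcl.mem_of_tendsto h6 (Eventually.of_forall fun t => ⟨_, rfl⟩)
    exact this
  have hinj : Function.Injective J' :=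
    (LinearMap.injective_iff_surjective (f := (J' : H →ₗ[ℝ] H))).2 hsurj
  let e : H ≃ₗ[ℝ] H := LinearEquiv.ofBijective (J' : H →ₗ[ℝ] H) ⟨hinj, hsurj⟩
  let B : H →L[ℝ] H := LinearMap.toContinuousLinearMap (e.symm : H →ₗ[ℝ] H)
  have hBJ : ∀ w, B (J' w) = w := fun w => e.symm_apply_apply w
  refine ⟨B, ?_⟩
  have h8 : (fun h => B (h - J' (Y (x + h) - Y x))) =o[𝓝 0] (fun h : H => h) :=
    (B.isBigO_comp _ _).trans_isLittleO h1
  refine h8.neg_left.congr_left fun h => ?_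
  rw [map_sub, hBJ, neg_sub]

theorem norm_le_of_forall_inner_le {w d : H} {C : ℝ} (hC : 0 ≤ C)
    (h : ∀ k, inner ℝ w k ≤ C * ‖d + k‖ ^ 2) : ‖w‖ ≤ 4 * (C + 1) * ‖d‖ := by
  set t : ℝ := 1 / (4 * (C + 1)) with ht
  have htpos : 0 < t := by positivity
  have h1 := h (t • w)
  rw [inner_smul_right, real_inner_self_eq_norm_sq] at h1
  have h2 : ‖d + t • w‖ ≤ ‖d‖ + t * ‖w‖ := by
    refine (norm_add_le _ _).trans (le_of_eq ?_)
    rw [norm_smul, Real.norm_of_nonneg htpos.le]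
  have h3 : ‖d + t • w‖ ^ 2 ≤ 2 * ‖d‖ ^ 2 + 2 * t ^ 2 * ‖w‖ ^ 2 := by
    have := pow_le_pow_left₀ (norm_nonneg _) h2 2
    nlinarith [sq_nonneg (‖d‖ - t * ‖w‖)]
  have h4 : C * t ≤ 1 / 4 := by
    rw [ht, mul_one_div, div_le_div_iff₀ (by positivity) (by norm_num)]; linarith
  have h5 : t * ‖w‖ ^ 2 ≤ 4 * C * ‖d‖ ^ 2 := by
    have := mul_le_mul_of_nonneg_left h3 hC
    have h6 : C * t * (t * ‖w‖ ^ 2) ≤ 1 / 4 * (t * ‖w‖ ^ 2) := by gcongr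
    nlinarith
  have h7 : ‖w‖ ^ 2 ≤ (4 * (C + 1) * ‖d‖) ^ 2 := by
    have h8 : t * (4 * (C + 1)) = 1 := by rw [ht]; field_simp
    have h9 := mul_le_mul_of_nonneg_left h5 (show 0 ≤ 4 * (C + 1) by positivity)
    nlinarith [sq_nonneg ‖d‖]
  exact le_of_sq_le_sq h7 (by positivity)

/-- Combination of Jensen's lemma and Aleksandrov's theorem: if the semiconvex function
`f - C‖·‖²` attains its maximum after every small linear perturbation, then for some small
perturbation the function `f` is twice differentiable at a maximum point. -/
theorem exists_second_order_expansion_at_max [FiniteDimensional ℝ H] {f : H → ℝ} {q : H → H}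
    (hq : ∀ x x', f x + inner ℝ (q x) (x' - x) ≤ f x') {C r : ℝ} (hC : 0 ≤ C) (hr : 0 < r)
    (hmax : ∀ p : H, ‖p‖ < r → ∃ x, ∀ x',
      f x' - C * ‖x'‖ ^ 2 - inner ℝ p x' ≤ f x - C * ‖x‖ ^ 2 - inner ℝ p x) :
    ∃ p x : H, ‖p‖ < r ∧
      (∀ x', f x' - C * ‖x'‖ ^ 2 - inner ℝ p x' ≤ f x - C * ‖x‖ ^ 2 - inner ℝ p x) ∧
      ∃ B : H →L[ℝ] H, ∀ ε > 0, ∀ᶠ h in 𝓝 (0 : H),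
        |f (x + h) - f x - inner ℝ (p + (2 * C) • x) h - 1 / 2 * inner ℝ (B h) h| ≤
          ε * ‖h‖ ^ 2 := by
  borelize H
  let μ : MeasureTheory.Measure H :=
    MeasureTheory.Measure.hausdorffMeasure (Module.finrank ℝ H : ℝ)
  let Y : H → H := fun x => x + q x
  have hY : ∀ x x', ‖x - x'‖ ≤ ‖Y x - Y x'‖ := by
    intro x x'
    have h1 := hq x x'
    have h2 := hq x' x
    have h3 : 0 ≤ inner ℝ (q x - q x') (x - x') := by
      rw [inner_sub_left]
      rw [← neg_sub x x', inner_neg_right] at h1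
      linarith
    have h4 : Y x - Y x' = (x - x') + (q x - q x') := by simp only [Y]; abel
    have h5 : ‖x - x'‖ ^ 2 ≤ ‖Y x - Y x'‖ * ‖x - x'‖ := by
      refine le_trans ?_ (real_inner_le_norm _ _)
      rw [h4, inner_add_left, real_inner_self_eq_norm_sq]
      linarith
    by_cases h6 : ‖x - x'‖ = 0
    · rw [h6]; positivity
    · have h7 : 0 < ‖x - x'‖ := lt_of_le_of_ne (norm_nonneg _) (Ne.symm h6)
      rw [sq] at h5
      exact le_of_mul_le_mul_right h5 h7
  have hYinj : Function.Injective Y := by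
    intro x x' h
    have := hY x x'
    rw [h, sub_self, norm_zero] at this
    exact sub_eq_zero.1 (norm_le_zero_iff.1 this)
  let J : H → H := Function.invFun Y
  have hJ : ∀ x, J (Y x) = x := Function.leftInverse_invFun hYinj
  have hJlip : LipschitzOnWith 1 J (range Y) := by
    refine LipschitzOnWith.of_dist_le_mul ?_
    rintro _ ⟨x, rfl⟩ _ ⟨x', rfl⟩
    rw [hJ, hJ, dist_eq_norm, dist_eq_norm]
    simpa using hY x x'
  let T : H → H := fun y => y - (1 + 2 * C) • J y
  have hT : LipschitzOnWith (1 + (Real.toNNReal (1 + 2 * C)) * 1) T (range Y) := by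
    refine LipschitzOnWith.of_dist_le_mul ?_
    intro y hy y' hy'
    have h1 := hJlip.dist_le_mul y hy y' hy'
    rw [dist_eq_norm, dist_eq_norm] at h1 ⊢
    have h2 : T y - T y' = (y - y') - (1 + 2 * C) • (J y - J y') := by
      simp only [T, smul_sub]; abel
    rw [h2]
    refine (norm_sub_le _ _).trans ?_
    rw [norm_smul, Real.norm_of_nonneg (by positivity)]
    push_cast
    rw [Real.coe_toNNReal _ (by positivity)]
    simp only [NNReal.coe_one, one_mul] at h1
    nlinarith
  have hae := hJlip.ae_differentiableWithinAt_of_mem (μ := μ)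
  let N : Set H := {y | ¬ (y ∈ range Y → DifferentiableWithinAt ℝ J (range Y) y)}
  have hN : μ N = 0 := hae
  have hNsub : N ⊆ range Y := fun y hy => by
    by_contra h
    exact hy fun h' => absurd h' h
  have hTN : μ (T '' N) = 0 := by
    have := (hT.mono hNsub).hausdorffMeasure_image_le (d := (Module.finrank ℝ H : ℝ))
      (Nat.cast_nonneg _)
    refine le_antisymm (this.trans ?_) zero_le
    have hN' : MeasureTheory.Measure.hausdorffMeasure (Module.finrank ℝ H : ℝ) N = 0 := hN
    rw [hN', mul_zero]
  obtain ⟨p, hp, hpN⟩ : ∃ p ∈ Metric.ball (0 : H) r, p ∉ T '' N := by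
    by_contra! hcon
    have h1 : μ (Metric.ball (0 : H) r) ≤ 0 := (MeasureTheory.measure_mono hcon).trans hTN.le
    exact absurd (Metric.measure_ball_pos μ (0 : H) hr) (not_lt.2 h1)
  rw [Metric.mem_ball, dist_zero_right] at hp
  obtain ⟨x, hx⟩ := hmax p hp
  have htouch : ∀ x', f x' ≤ f x + inner ℝ (p + (2 * C) • x) (x' - x) + C * ‖x' - x‖ ^ 2 := by
    intro x'
    have h1 := hx x'
    have h2 : ‖x'‖ ^ 2 = ‖x‖ ^ 2 + 2 * inner ℝ x (x' - x) + ‖x' - x‖ ^ 2 := by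
      rw [← norm_add_sq_real]; simp
    rw [h2] at h1
    rw [inner_add_left, inner_smul_left]
    have h3 : inner ℝ p (x' - x) = inner ℝ p x' - inner ℝ p x := inner_sub_right _ _ _
    simp only [RCLike.conj_to_real]
    linarith
  have hqx : q x = p + (2 * C) • x := by
    have := norm_le_of_forall_inner_le (w := q x - (p + (2 * C) • x)) (d := 0) hC (by
      intro k
      have h1 := hq x (x + k)
      have h2 := htouch (x + k)
      rw [add_sub_cancel_left] at h1 h2
      rw [inner_sub_left, zero_add]
      linarith)
    rw [norm_zero, mul_zero] at this
    exact sub_eq_zero.1 (norm_le_zero_iff.1 this)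
  have hqlip : ∀ x', ‖q x' - q x‖ ≤ 4 * (C + 1) * ‖x' - x‖ := by
    intro x'
    refine norm_le_of_forall_inner_le hC fun k => ?_
    have h1 := hq x' (x' + k)
    have h2 := htouch (x' + k)
    have h3 := hq x x'
    rw [add_sub_cancel_left] at h1
    rw [add_sub_right_comm, ← hqx, inner_add_right] at h2
    rw [inner_sub_left]
    linarith
  have hYx : T (Y x) = p := by
    have h1 : T (Y x) = Y x - (1 + 2 * C) • x := by simp only [T, hJ]
    have h2 : Y x = x + q x := rfl
    rw [h1, h2, hqx, add_smul, one_smul]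
    abel
  have hdiff : DifferentiableWithinAt ℝ J (range Y) (Y x) := by
    by_contra h
    exact hpN ⟨Y x, fun h' => h (h' (mem_range_self x)), hYx⟩
  obtain ⟨B, hB⟩ := exists_expansion_of_leftInverse hJ hdiff (L := 1 + 4 * (C + 1)) (by
    intro x'
    have h4 : Y x' - Y x = (x' - x) + (q x' - q x) := by simp only [Y]; abel
    rw [h4, add_mul, one_mul]
    exact (norm_add_le _ _).trans (by gcongr; exact hqlip x'))
  have hB' : (fun h => q (x + h) - q x - (B - ContinuousLinearMap.id ℝ H) h) =o[𝓝 0]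
      (fun h : H => h) := by
    refine hB.congr_left fun h => ?_
    simp only [Y, _root_.sub_apply, ContinuousLinearMap.id_apply]
    abel
  refine ⟨p, x, hp, hx, B - ContinuousLinearMap.id ℝ H, fun ε hε => ?_⟩
  rw [← hqx]
  exact second_order_expansion_of_subgradient hq hB' hε

end Aleksandrov

section TheoremOnSums

variable {E : Type*} [NormedAddCommGroup E] [InnerProductSpace ℝ E] [FiniteDimensional ℝ E]

theorem exists_symmetric_quadratic_form_eq (B : E →L[ℝ] E) :
    ∃ X : E →L[ℝ] E, (∀ a b, inner ℝ (X a) b = inner ℝ a (X b)) ∧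
      ∀ a, inner ℝ (X a) a = inner ℝ (B a) a := by
  have := FiniteDimensional.complete ℝ E
  refine ⟨(1 / 2 : ℝ) • (B + ContinuousLinearMap.adjoint B), fun a b => ?_, fun a => ?_⟩
  · simp only [_root_.smul_apply, _root_.add_apply, inner_smul_left, inner_smul_right,
      inner_add_left, inner_add_right, ContinuousLinearMap.adjoint_inner_left,
      ContinuousLinearMap.adjoint_inner_right, RCLike.conj_to_real]
    ring
  · simp only [_root_.smul_apply, _root_.add_apply, inner_smul_left,
      inner_add_left, ContinuousLinearMap.adjoint_inner_left, RCLike.conj_to_real]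
    rw [real_inner_comm (B a) a]
    ring

theorem exists_sup_convolution {G : E → ℝ} (hG : Continuous G) (c : ℝ) {ρ : ℝ} (hρ : 0 ≤ ρ) :
    ∃ (U : E → ℝ) (ζ : E → E), (∀ x, ‖ζ x‖ ≤ ρ) ∧ (∀ x, U x = G (ζ x) - c * ‖x - ζ x‖ ^ 2) ∧
      ∀ x z, ‖z‖ ≤ ρ → G z - c * ‖x - z‖ ^ 2 ≤ U x := by
  have : ProperSpace E := FiniteDimensional.proper ℝ E
  have h : ∀ x : E, ∃ z ∈ Metric.closedBall (0 : E) ρ,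
      ∀ z' ∈ Metric.closedBall (0 : E) ρ, G z' - c * ‖x - z'‖ ^ 2 ≤ G z - c * ‖x - z‖ ^ 2 := by
    intro x
    have hcont : Continuous fun z => G z - c * ‖x - z‖ ^ 2 := by fun_prop
    exact (isCompact_closedBall (0 : E) ρ).exists_isMaxOn
      ⟨0, Metric.mem_closedBall_self hρ⟩ hcont.continuousOn
  choose ζ hζ hmax using h
  refine ⟨fun x => G (ζ x) - c * ‖x - ζ x‖ ^ 2, ζ, fun x => by simpa using hζ x,
    fun x => rfl, fun x z hz => hmax x z (by simpa using hz)⟩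

set_option maxHeartbeats 1000000 in
/-- The theorem on sums at the origin, for a strict maximum with respect to a quadratic form. -/
theorem exists_jets_of_strict_max {G₁ G₂ : E → ℝ} (hG₁ : Continuous G₁) (hG₂ : Continuous G₂)
    (h₁ : G₁ 0 = 0) (h₂ : G₂ 0 = 0)
    {A : WithLp 2 (E × E) →L[ℝ] WithLp 2 (E × E)}
    (hA : ∀ ξ ζ, inner ℝ (A ξ) ζ = inner ℝ ξ (A ζ)) {η : ℝ} (hη : 0 < η)
    (hloc : ∀ᶠ ξ in 𝓝 (0 : WithLp 2 (E × E)),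
      G₁ ξ.fst + G₂ ξ.snd ≤ 1 / 2 * inner ℝ (A ξ) ξ - η * ‖ξ‖ ^ 2) {δ : ℝ} (hδ : 0 < δ) :
    ∃ (z₁ z₂ P₁ P₂ : E) (X₁ X₂ : E →L[ℝ] E), ‖z₁‖ < δ ∧ ‖z₂‖ < δ ∧ ‖P₁‖ < δ ∧ ‖P₂‖ < δ ∧
      (∀ a b, inner ℝ (X₁ a) b = inner ℝ a (X₁ b)) ∧
      (∀ a b, inner ℝ (X₂ a) b = inner ℝ a (X₂ b)) ∧
      (∀ᶠ a in 𝓝 (0 : E), G₁ (z₁ + a) ≤ G₁ z₁ + inner ℝ P₁ a + 1 / 2 * inner ℝ (X₁ a) a) ∧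
      (∀ᶠ a in 𝓝 (0 : E), G₂ (z₂ + a) ≤ G₂ z₂ + inner ℝ P₂ a + 1 / 2 * inner ℝ (X₂ a) a) ∧
      ∀ a b, inner ℝ (X₁ a) a + inner ℝ (X₂ b) b ≤
        inner ℝ (A (WithLp.toLp 2 (a, b))) (WithLp.toLp 2 (a, b)) +
          δ * (‖a‖ ^ 2 + ‖b‖ ^ 2) := by
  have : ProperSpace E := FiniteDimensional.proper ℝ E
  have : ProperSpace (WithLp 2 (E × E)) := FiniteDimensional.proper ℝ _
  obtain ⟨r₀, hr₀, hball⟩ := Metric.eventually_nhds_iff.1 hloc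
  set N := ‖A‖ with hN
  have hN0 : 0 ≤ N := by rw [hN]; exact norm_nonneg A
  have hAle : ∀ ξ ζ, |inner ℝ (A ξ) ζ| ≤ N * ‖ξ‖ * ‖ζ‖ := fun ξ ζ =>
    (abs_real_inner_le_norm _ _).trans (by gcongr; exact A.le_opNorm ξ)
  set ρ := r₀ / 2 with hρdef
  have hρ : 0 < ρ := by positivity
  set c := N ^ 2 / (2 * η) + N / 2 + η / 2 with hc
  have hc0 : 0 < c := by positivity
  obtain ⟨U₁, ζ₁, hζ₁, hU₁, hU₁'⟩ := exists_sup_convolution hG₁ c hρ.le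
  obtain ⟨U₂, ζ₂, hζ₂, hU₂, hU₂'⟩ := exists_sup_convolution hG₂ c hρ.le
  let ζ : WithLp 2 (E × E) → WithLp 2 (E × E) := fun ξ => WithLp.toLp 2 (ζ₁ ξ.fst, ζ₂ ξ.snd)
  let V : WithLp 2 (E × E) → ℝ := fun ξ => U₁ ξ.fst + U₂ ξ.snd
  have hVζ : ∀ ξ, V ξ = G₁ (ζ ξ).fst + G₂ (ζ ξ).snd - c * ‖ξ - ζ ξ‖ ^ 2 := by
    intro ξ
    rw [WithLp.prod_norm_sq_eq_of_L2]
    simp only [V, hU₁, hU₂, ζ, WithLp.sub_fst, WithLp.sub_snd, WithLp.toLp_fst, WithLp.toLp_snd]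
    ring
  have hVge : ∀ ξ z : WithLp 2 (E × E), ‖z.fst‖ ≤ ρ → ‖z.snd‖ ≤ ρ →
      G₁ z.fst + G₂ z.snd - c * ‖ξ - z‖ ^ 2 ≤ V ξ := by
    intro ξ z hz1 hz2
    rw [WithLp.prod_norm_sq_eq_of_L2, WithLp.sub_fst, WithLp.sub_snd]
    have a1 := hU₁' ξ.fst z.fst hz1
    have a2 := hU₂' ξ.snd z.snd hz2
    simp only [V]
    linarith
  have hζloc : ∀ ξ, G₁ (ζ ξ).fst + G₂ (ζ ξ).snd ≤
      1 / 2 * inner ℝ (A (ζ ξ)) (ζ ξ) - η * ‖ζ ξ‖ ^ 2 := by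
    intro ξ
    refine hball ?_
    rw [dist_zero_right]
    refine lt_of_pow_lt_pow_left₀ 2 hr₀.le ?_
    rw [WithLp.prod_norm_sq_eq_of_L2]
    have a1 := pow_le_pow_left₀ (norm_nonneg _) (hζ₁ ξ.fst) 2
    have a2 := pow_le_pow_left₀ (norm_nonneg _) (hζ₂ ξ.snd) 2
    have a3 : ρ ^ 2 + ρ ^ 2 = r₀ ^ 2 / 2 := by rw [hρdef]; ring
    have a4 : 0 < r₀ ^ 2 := by positivity
    simp only [ζ, WithLp.toLp_fst, WithLp.toLp_snd]
    linarith
  have hquad : ∀ ξ h, inner ℝ (A (ξ + h)) (ξ + h) =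
      inner ℝ (A ξ) ξ + 2 * inner ℝ (A ξ) h + inner ℝ (A h) h := by
    intro ξ h
    rw [map_add, inner_add_left, inner_add_right, inner_add_right, hA h ξ,
      real_inner_comm (A ξ) h]
    ring
  have hsmall : ∀ p ξ, 0 ≤ V ξ - 1 / 2 * inner ℝ (A ξ) ξ - inner ℝ p ξ →
      ‖ζ ξ‖ + ‖ξ - ζ ξ‖ ≤ 4 * ‖p‖ / η := by
    intro p ξ hpos
    have b0 := hζloc ξ
    have b1 := hVζ ξ
    have b2 := hquad (ζ ξ) (ξ - ζ ξ)
    rw [add_sub_cancel] at b2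
    have b3 := hAle (ζ ξ) (ξ - ζ ξ)
    have b4 := hAle (ξ - ζ ξ) (ξ - ζ ξ)
    have b5 : -(‖p‖ * (‖ζ ξ‖ + ‖ξ - ζ ξ‖)) ≤ inner ℝ p ξ := by
      have b6 := abs_real_inner_le_norm p ξ
      have b7 : ‖ξ‖ ≤ ‖ζ ξ‖ + ‖ξ - ζ ξ‖ := by
        simpa using norm_add_le (ζ ξ) (ξ - ζ ξ)
      have b8 := mul_le_mul_of_nonneg_left b7 (norm_nonneg p)
      linarith [neg_abs_le (inner ℝ p ξ)]
    have b3' := neg_abs_le (inner ℝ (A (ζ ξ)) (ξ - ζ ξ))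
    have b4' := neg_abs_le (inner ℝ (A (ξ - ζ ξ)) (ξ - ζ ξ))
    set s := ‖ζ ξ‖
    set d := ‖ξ - ζ ξ‖
    have hs : 0 ≤ s := norm_nonneg _
    have hd : 0 ≤ d := norm_nonneg _
    have b9 : N * s * d ≤ η / 2 * s ^ 2 + N ^ 2 / (2 * η) * d ^ 2 := by
      have : η / 2 * s ^ 2 + N ^ 2 / (2 * η) * d ^ 2 - N * s * d =
          (η * s - N * d) ^ 2 / (2 * η) := by field_simp; ring
      have : 0 ≤ (η * s - N * d) ^ 2 / (2 * η) := by positivity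
      linarith
    have b10 : c * d ^ 2 = N ^ 2 / (2 * η) * d ^ 2 + N / 2 * d ^ 2 + η / 2 * d ^ 2 := by
      rw [hc]; ring
    have b11 : η / 4 * (s + d) ^ 2 ≤ ‖p‖ * (s + d) := by
      have b12 : 0 ≤ η * (s - d) ^ 2 := by positivity
      nlinarith
    rcases (add_nonneg hs hd).eq_or_lt with h0 | h0
    · rw [← h0]; positivity
    · rw [sq, ← mul_assoc] at b11
      have := le_of_mul_le_mul_right b11 h0
      rw [le_div_iff₀ hη]; linarith
  have hzero : 0 ≤ V 0 := by
    have := hVge 0 0 (by simpa using hρ.le) (by simpa using hρ.le)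
    simpa [h₁, h₂] using this
  set C := c + N with hC
  let f : WithLp 2 (E × E) → ℝ := fun ξ => V ξ - 1 / 2 * inner ℝ (A ξ) ξ + C * ‖ξ‖ ^ 2
  let q : WithLp 2 (E × E) → WithLp 2 (E × E) := fun ξ =>
    (2 * c) • ζ ξ + (2 * N) • ξ - A ξ
  have hq : ∀ ξ ξ', f ξ + inner ℝ (q ξ) (ξ' - ξ) ≤ f ξ' := by
    intro ξ ξ'
    have a1 := hVge ξ' (ζ ξ) (hζ₁ _) (hζ₂ _)
    have a2 := hVζ ξ
    obtain ⟨h, rfl⟩ : ∃ h, ξ' = ξ + h := ⟨ξ' - ξ, by abel⟩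
    rw [add_sub_cancel_left]
    have a3 : ‖ξ + h - ζ ξ‖ ^ 2 = ‖ξ - ζ ξ‖ ^ 2 + 2 * inner ℝ (ξ - ζ ξ) h + ‖h‖ ^ 2 := by
      rw [add_sub_right_comm, norm_add_sq_real]
    have a4 := norm_add_sq_real ξ h
    have a5 := hquad ξ h
    have a6 := (le_abs_self _).trans (hAle h h)
    rw [inner_sub_left] at a3
    have a8 := mul_nonneg hN0 (sq_nonneg ‖h‖)
    simp only [f, q, inner_sub_left, inner_add_left, inner_smul_left, RCLike.conj_to_real]
    rw [a4, a5, hC]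
    rw [a3] at a1
    nlinarith
  set m := min δ ρ with hm
  have hm0 : 0 < m := lt_min hδ hρ
  set κ := 1 + 4 * (N + 1) / η with hκ
  have hκ0 : 0 < κ := by positivity
  have hr : 0 < m / κ := by positivity
  have hp_small : ∀ p : WithLp 2 (E × E), ‖p‖ < m / κ →
      4 * ‖p‖ / η < m ∧ ‖p‖ + N * (4 * ‖p‖ / η) < m := by
    intro p hp
    rw [lt_div_iff₀ hκ0] at hp
    have e1 : ‖p‖ * κ = ‖p‖ + N * (4 * ‖p‖ / η) + 4 * ‖p‖ / η := by
      rw [hκ]; field_simp; ring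
    have e2 : 0 ≤ 4 * ‖p‖ / η := by positivity
    have e3 : 0 ≤ N * (4 * ‖p‖ / η) := by positivity
    have e4 := norm_nonneg p
    constructor <;> linarith
  have hfV : ∀ p ξ, f ξ - C * ‖ξ‖ ^ 2 - inner ℝ p ξ =
      V ξ - 1 / 2 * inner ℝ (A ξ) ξ - inner ℝ p ξ := by
    intro p ξ; simp only [f]; ring
  have hmax : ∀ p : WithLp 2 (E × E), ‖p‖ < m / κ → ∃ ξ, ∀ ξ',
      f ξ' - C * ‖ξ'‖ ^ 2 - inner ℝ p ξ' ≤ f ξ - C * ‖ξ‖ ^ 2 - inner ℝ p ξ := by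
    intro p _
    simp only [hfV]
    set R := 4 * ‖p‖ / η
    have hR : 0 ≤ R := by positivity
    let Φ : WithLp 2 (E × E) × WithLp 2 (E × E) → ℝ := fun w =>
      G₁ w.2.fst + G₂ w.2.snd - c * ‖w.1 - w.2‖ ^ 2 - 1 / 2 * inner ℝ (A w.1) w.1 - inner ℝ p w.1
    have hΦ : Continuous Φ := by
      have c1 : Continuous fun w : WithLp 2 (E × E) × WithLp 2 (E × E) => w.2.fst :=
        (WithLp.fstL 2 ℝ E E).continuous.comp continuous_snd
      have c2 : Continuous fun w : WithLp 2 (E × E) × WithLp 2 (E × E) => w.2.snd :=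
        (WithLp.sndL 2 ℝ E E).continuous.comp continuous_snd
      have c3 := hG₁.comp c1
      have c4 := hG₂.comp c2
      have c5 : Continuous fun w : WithLp 2 (E × E) × WithLp 2 (E × E) =>
          c * ‖w.1 - w.2‖ ^ 2 := by fun_prop
      have c6 : Continuous fun w : WithLp 2 (E × E) × WithLp 2 (E × E) =>
          1 / 2 * (inner ℝ (A w.1) w.1 : ℝ) := by fun_prop
      have c7 : Continuous fun w : WithLp 2 (E × E) × WithLp 2 (E × E) =>
          (inner ℝ p w.1 : ℝ) := by fun_prop
      exact (((c3.add c4).sub c5).sub c6).sub c7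
    let S : Set (WithLp 2 (E × E)) := {z | ‖z.fst‖ ≤ ρ ∧ ‖z.snd‖ ≤ ρ}
    have hS : IsCompact S := by
      refine (isCompact_closedBall (0 : WithLp 2 (E × E)) (2 * ρ)).of_isClosed_subset ?_ ?_
      · have c1 : Continuous fun z : WithLp 2 (E × E) => ‖z.fst‖ :=
          (WithLp.fstL 2 ℝ E E).continuous.norm
        have c2 : Continuous fun z : WithLp 2 (E × E) => ‖z.snd‖ :=
          (WithLp.sndL 2 ℝ E E).continuous.norm
        exact (isClosed_le c1 continuous_const).inter (isClosed_le c2 continuous_const)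
      · rintro z ⟨hz1, hz2⟩
        rw [mem_closedBall_zero_iff]
        refine le_of_sq_le_sq ?_ (by positivity)
        rw [WithLp.prod_norm_sq_eq_of_L2]
        have a1 := pow_le_pow_left₀ (norm_nonneg _) hz1 2
        have a2 := pow_le_pow_left₀ (norm_nonneg _) hz2 2
        nlinarith
    obtain ⟨⟨ξ, z⟩, ⟨hξ, hz⟩, hw⟩ :=
      ((isCompact_closedBall (0 : WithLp 2 (E × E)) R).prod hS).exists_isMaxOn
        ⟨(0, 0), by
          constructor
          · simpa using hR
          · simpa [S] using hρ.le⟩ hΦ.continuousOn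
    have hval : ∀ ξ', ‖ξ'‖ ≤ R → V ξ' - 1 / 2 * inner ℝ (A ξ') ξ' - inner ℝ p ξ' ≤
        V ξ - 1 / 2 * inner ℝ (A ξ) ξ - inner ℝ p ξ := by
      intro ξ' hξ'
      have e1 : Φ (ξ', ζ ξ') ≤ Φ (ξ, z) :=
        hw ⟨by simpa using hξ', ⟨hζ₁ _, hζ₂ _⟩⟩
      have e2 := hVge ξ z hz.1 hz.2
      have e3 := hVζ ξ'
      simp only [Φ] at e1
      linarith
    refine ⟨ξ, fun ξ' => ?_⟩
    by_cases h : 0 ≤ V ξ' - 1 / 2 * inner ℝ (A ξ') ξ' - inner ℝ p ξ'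
    · refine hval ξ' ?_
      have e1 := hsmall p ξ' h
      have e2 : ‖ξ'‖ ≤ ‖ζ ξ'‖ + ‖ξ' - ζ ξ'‖ := by simpa using norm_add_le (ζ ξ') (ξ' - ζ ξ')
      exact e2.trans e1
    · have := hval 0 (by simpa using hR)
      simp only [map_zero, inner_zero_right] at this
      linarith
  obtain ⟨p, ξ, hp, hξmax, B, hB⟩ :=
    exists_second_order_expansion_at_max hq (by positivity : 0 ≤ C) hr hmax
  obtain ⟨hp1, hp2⟩ := hp_small p hp
  simp only [hfV] at hξmax
  have hξsmall : ‖ζ ξ‖ + ‖ξ - ζ ξ‖ ≤ 4 * ‖p‖ / η := by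
    refine hsmall p ξ ?_
    have := hξmax 0
    simp only [map_zero, inner_zero_right] at this
    linarith
  set P := p + A ξ with hP
  have hPnorm : ‖P‖ < m := by
    have e2 : ‖ξ‖ ≤ ‖ζ ξ‖ + ‖ξ - ζ ξ‖ := by simpa using norm_add_le (ζ ξ) (ξ - ζ ξ)
    have e3 : ‖A ξ‖ ≤ N * ‖ξ‖ := A.le_opNorm ξ
    have e4 : N * ‖ξ‖ ≤ N * (4 * ‖p‖ / η) := by gcongr; linarith
    have := norm_add_le p (A ξ)
    linarith
  let M : WithLp 2 (E × E) →L[ℝ] WithLp 2 (E × E) :=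
    B + A - (2 * C) • ContinuousLinearMap.id ℝ _
  have hVexp : ∀ ε > 0, ∀ᶠ h in 𝓝 (0 : WithLp 2 (E × E)),
      |V (ξ + h) - V ξ - inner ℝ P h - 1 / 2 * inner ℝ (M h) h| ≤ ε * ‖h‖ ^ 2 := by
    intro ε hε
    filter_upwards [hB ε hε] with h hh
    have e1 := hquad ξ h
    have e2 := norm_add_sq_real ξ h
    convert hh using 2
    simp only [f, M, hP, inner_sub_left, inner_add_left, inner_smul_left, RCLike.conj_to_real,
      _root_.sub_apply, _root_.add_apply, _root_.smul_apply, ContinuousLinearMap.id_apply,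
      real_inner_self_eq_norm_sq]
    rw [e1, e2]
    ring
  have hVmax : ∀ h, V (ξ + h) - V ξ ≤ inner ℝ P h + 1 / 2 * inner ℝ (A h) h := by
    intro h
    have e1 := hξmax (ξ + h)
    rw [hquad, inner_add_right] at e1
    rw [hP, inner_add_left]
    linarith
  let ι₁ : E →L[ℝ] WithLp 2 (E × E) :=
    ((WithLp.prodContinuousLinearEquiv 2 ℝ E E).symm : (E × E) →L[ℝ] WithLp 2 (E × E)) ∘L
      ContinuousLinearMap.inl ℝ E E
  let ι₂ : E →L[ℝ] WithLp 2 (E × E) :=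
    ((WithLp.prodContinuousLinearEquiv 2 ℝ E E).symm : (E × E) →L[ℝ] WithLp 2 (E × E)) ∘L
      ContinuousLinearMap.inr ℝ E E
  have hι₁ : ∀ a, ι₁ a = WithLp.toLp 2 (a, 0) := fun a => rfl
  have hι₂ : ∀ a, ι₂ a = WithLp.toLp 2 (0, a) := fun a => rfl
  have hnι₁ : ∀ a, ‖ι₁ a‖ ^ 2 = ‖a‖ ^ 2 := fun a => by
    rw [WithLp.prod_norm_sq_eq_of_L2, hι₁]; simp
  have hnι₂ : ∀ a, ‖ι₂ a‖ ^ 2 = ‖a‖ ^ 2 := fun a => by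
    rw [WithLp.prod_norm_sq_eq_of_L2, hι₂]; simp
  have hiι₁ : ∀ ω a, inner ℝ ω (ι₁ a) = inner ℝ ω.fst a := fun ω a => by
    rw [WithLp.prod_inner_apply, hι₁]; simp
  have hiι₂ : ∀ ω a, inner ℝ ω (ι₂ a) = inner ℝ ω.snd a := fun ω a => by
    rw [WithLp.prod_inner_apply, hι₂]; simp
  have hVι₁ : ∀ a, V (ξ + ι₁ a) - V ξ = U₁ (ξ.fst + a) - U₁ ξ.fst := fun a => by
    simp [V, hι₁]
  have hVι₂ : ∀ a, V (ξ + ι₂ a) - V ξ = U₂ (ξ.snd + a) - U₂ ξ.snd := fun a => by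
    simp [V, hι₂]
  set ε := δ / 4 with hεdef
  have hε : 0 < ε := by positivity
  have hexp₁ : ∀ᶠ a in 𝓝 (0 : E), |U₁ (ξ.fst + a) - U₁ ξ.fst - inner ℝ P.fst a -
      1 / 2 * inner ℝ (M (ι₁ a)) (ι₁ a)| ≤ ε * ‖a‖ ^ 2 := by
    have ht : Tendsto ι₁ (𝓝 0) (𝓝 0) := by
      simpa using ι₁.continuous.tendsto 0
    filter_upwards [ht.eventually (hVexp ε hε)] with a ha
    rwa [hVι₁, hnι₁, hiι₁ P] at ha
  have hexp₂ : ∀ᶠ a in 𝓝 (0 : E), |U₂ (ξ.snd + a) - U₂ ξ.snd - inner ℝ P.snd a -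
      1 / 2 * inner ℝ (M (ι₂ a)) (ι₂ a)| ≤ ε * ‖a‖ ^ 2 := by
    have ht : Tendsto ι₂ (𝓝 0) (𝓝 0) := by
      simpa using ι₂.continuous.tendsto 0
    filter_upwards [ht.eventually (hVexp ε hε)] with a ha
    rwa [hVι₂, hnι₂, hiι₂ P] at ha
  have hkey : ∀ a b, inner ℝ (M (ι₁ a)) (ι₁ a) + inner ℝ (M (ι₂ b)) (ι₂ b) ≤
      inner ℝ (A (WithLp.toLp 2 (a, b))) (WithLp.toLp 2 (a, b)) +
        2 * ε * (‖a‖ ^ 2 + ‖b‖ ^ 2) := by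
    intro a b
    have hta : Tendsto (fun t : ℝ => t • a) (𝓝[≠] 0) (𝓝 0) := by
      have : Tendsto (fun t : ℝ => t • a) (𝓝 0) (𝓝 ((0 : ℝ) • a)) := tendsto_id.smul_const a
      rw [zero_smul] at this
      exact this.mono_left nhdsWithin_le_nhds
    have htb : Tendsto (fun t : ℝ => t • b) (𝓝[≠] 0) (𝓝 0) := by
      have : Tendsto (fun t : ℝ => t • b) (𝓝 0) (𝓝 ((0 : ℝ) • b)) := tendsto_id.smul_const b
      rw [zero_smul] at this
      exact this.mono_left nhdsWithin_le_nhds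
    obtain ⟨t, ⟨ha, hb⟩, ht⟩ :=
      (((hta.eventually hexp₁).and (htb.eventually hexp₂)).and self_mem_nhdsWithin).exists
    have ht0 : 0 < t ^ 2 := by
      have : t ≠ 0 := ht
      positivity
    have e1 := hVmax (t • WithLp.toLp 2 (a, b))
    have e2 : V (ξ + t • WithLp.toLp 2 (a, b)) - V ξ =
        (U₁ (ξ.fst + t • a) - U₁ ξ.fst) + (U₂ (ξ.snd + t • b) - U₂ ξ.snd) := by
      simp only [V, WithLp.add_fst, WithLp.add_snd, WithLp.smul_fst, WithLp.smul_snd,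
        WithLp.toLp_fst, WithLp.toLp_snd]
      ring
    have e3 : inner ℝ P (t • WithLp.toLp 2 (a, b)) =
        inner ℝ P.fst (t • a) + inner ℝ P.snd (t • b) := by
      rw [WithLp.prod_inner_apply]; rfl
    rw [e2, e3] at e1
    have a1 := (abs_le.1 ha).1
    have b1 := (abs_le.1 hb).1
    simp only [map_smul, inner_smul_left, inner_smul_right, RCLike.conj_to_real, norm_smul,
      mul_pow, Real.norm_eq_abs, sq_abs] at a1 b1 e1
    refine le_of_mul_le_mul_left ?_ ht0
    linarith
  obtain ⟨X₁, hX₁s, hX₁⟩ := exists_symmetric_quadratic_form_eq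
    ((WithLp.fstL 2 ℝ E E) ∘L M ∘L ι₁)
  obtain ⟨X₂, hX₂s, hX₂⟩ := exists_symmetric_quadratic_form_eq
    ((WithLp.sndL 2 ℝ E E) ∘L M ∘L ι₂)
  have hX₁' : ∀ a, inner ℝ (X₁ a) a = inner ℝ (M (ι₁ a)) (ι₁ a) := fun a => by
    rw [hX₁, hiι₁]; rfl
  have hX₂' : ∀ a, inner ℝ (X₂ a) a = inner ℝ (M (ι₂ a)) (ι₂ a) := fun a => by
    rw [hX₂, hiι₂]; rfl
  have hfst : ∀ ω : WithLp 2 (E × E), ‖ω.fst‖ ≤ ‖ω‖ := fun ω => by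
    refine le_of_sq_le_sq ?_ (norm_nonneg _)
    rw [WithLp.prod_norm_sq_eq_of_L2]; linarith [sq_nonneg ‖ω.snd‖]
  have hsnd : ∀ ω : WithLp 2 (E × E), ‖ω.snd‖ ≤ ‖ω‖ := fun ω => by
    refine le_of_sq_le_sq ?_ (norm_nonneg _)
    rw [WithLp.prod_norm_sq_eq_of_L2]; linarith [sq_nonneg ‖ω.fst‖]
  have hmδ : m ≤ δ := min_le_left _ _
  have hmρ : m ≤ ρ := min_le_right _ _
  have hd0 := norm_nonneg (ξ - ζ ξ)
  have hz₁ : ‖ζ₁ ξ.fst‖ < m := lt_of_le_of_lt (hfst (ζ ξ)) (by linarith)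
  have hz₂ : ‖ζ₂ ξ.snd‖ < m := lt_of_le_of_lt (hsnd (ζ ξ)) (by linarith)
  have hnear : ∀ z : E, ‖z‖ < m → ∀ᶠ a in 𝓝 (0 : E), ‖z + a‖ ≤ ρ := by
    intro z hz
    have : ContinuousAt (fun a : E => ‖z + a‖) 0 := by fun_prop
    have h0 : ‖z + 0‖ < ρ := by rw [add_zero]; linarith
    exact (this.eventually_lt continuousAt_const h0).mono fun a ha => ha.le
  refine ⟨ζ₁ ξ.fst, ζ₂ ξ.snd, P.fst, P.snd, X₁ + (2 * ε) • ContinuousLinearMap.id ℝ E,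
    X₂ + (2 * ε) • ContinuousLinearMap.id ℝ E, by linarith, by linarith,
    by linarith [hfst P], by linarith [hsnd P], ?_, ?_, ?_, ?_, ?_⟩
  · intro a b
    simp [inner_add_left, inner_add_right, inner_smul_left, inner_smul_right, hX₁s]
  · intro a b
    simp [inner_add_left, inner_add_right, inner_smul_left, inner_smul_right, hX₂s]
  · filter_upwards [hexp₁, hnear _ hz₁] with a ha hna
    have e1 := hU₁' (ξ.fst + a) _ hna
    rw [add_sub_add_right_eq_sub] at e1
    have e2 := hU₁ ξ.fst
    have e3 := (abs_le.1 ha).2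
    simp only [_root_.add_apply, _root_.smul_apply, ContinuousLinearMap.id_apply, inner_add_left,
      inner_smul_left, RCLike.conj_to_real, real_inner_self_eq_norm_sq, hX₁']
    linarith
  · filter_upwards [hexp₂, hnear _ hz₂] with a ha hna
    have e1 := hU₂' (ξ.snd + a) _ hna
    rw [add_sub_add_right_eq_sub] at e1
    have e2 := hU₂ ξ.snd
    have e3 := (abs_le.1 ha).2
    simp only [_root_.add_apply, _root_.smul_apply, ContinuousLinearMap.id_apply, inner_add_left,
      inner_smul_left, RCLike.conj_to_real, real_inner_self_eq_norm_sq, hX₂']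
    linarith
  · intro a b
    have e1 := hkey a b
    simp only [_root_.add_apply, _root_.smul_apply, ContinuousLinearMap.id_apply, inner_add_left,
      inner_smul_left, RCLike.conj_to_real, real_inner_self_eq_norm_sq, hX₁', hX₂']
    have e2 : δ = 4 * ε := by rw [hεdef]; ring
    rw [e2]
    linarith

/-- The theorem on sums: at a local maximum of `u₁ x + u₂ y` minus a quadratic polynomial there are
nearby points at which `u₁` and `u₂` have upper quadratic jets with ordered second-order parts. -/
theorem exists_jets_of_local_max {u₁ u₂ : E → ℝ} (hu₁ : Continuous u₁) (hu₂ : Continuous u₂)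
    {x₀ y₀ p₁ p₂ : E} {Z S : E →L[ℝ] E} (hZ : ∀ a b, inner ℝ (Z a) b = inner ℝ a (Z b))
    (hS : ∀ a b, inner ℝ (S a) b = inner ℝ a (S b))
    (hloc : ∀ᶠ w in 𝓝 (0 : E × E), u₁ (x₀ + w.1) + u₂ (y₀ + w.2) ≤
      u₁ x₀ + u₂ y₀ + inner ℝ p₁ w.1 + inner ℝ p₂ w.2 +
        1 / 2 * inner ℝ (Z (w.1 - w.2)) (w.1 - w.2) + 1 / 2 * inner ℝ (S w.1) w.1)
    {δ : ℝ} (hδ : 0 < δ) :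
    ∃ (x y P₁ P₂ : E) (X₁ X₂ : E →L[ℝ] E), dist x x₀ < δ ∧ dist y y₀ < δ ∧
      dist P₁ p₁ < δ ∧ dist P₂ p₂ < δ ∧
      (∀ a b, inner ℝ (X₁ a) b = inner ℝ a (X₁ b)) ∧
      (∀ a b, inner ℝ (X₂ a) b = inner ℝ a (X₂ b)) ∧
      (∀ᶠ a in 𝓝 (0 : E), u₁ (x + a) ≤ u₁ x + inner ℝ P₁ a + 1 / 2 * inner ℝ (X₁ a) a) ∧
      (∀ᶠ a in 𝓝 (0 : E), u₂ (y + a) ≤ u₂ y + inner ℝ P₂ a + 1 / 2 * inner ℝ (X₂ a) a) ∧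
      ∀ a b, inner ℝ (X₁ a) a + inner ℝ (X₂ b) b ≤
        inner ℝ (Z (a - b)) (a - b) + inner ℝ (S a) a + δ * (‖a‖ ^ 2 + ‖b‖ ^ 2) := by
  set η := δ / 4 with hη
  have hη0 : 0 < η := by positivity
  let D : WithLp 2 (E × E) →L[ℝ] E := WithLp.fstL 2 ℝ E E - WithLp.sndL 2 ℝ E E
  let A : WithLp 2 (E × E) →L[ℝ] WithLp 2 (E × E) :=
    ((WithLp.prodContinuousLinearEquiv 2 ℝ E E).symm : (E × E) →L[ℝ] WithLp 2 (E × E)) ∘L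
      ((Z ∘L D + S ∘L WithLp.fstL 2 ℝ E E).prod (-(Z ∘L D))) +
      (2 * η) • ContinuousLinearMap.id ℝ _
  have hAin : ∀ ξ ζ, inner ℝ (A ξ) ζ = inner ℝ (Z (ξ.fst - ξ.snd)) (ζ.fst - ζ.snd) +
      inner ℝ (S ξ.fst) ζ.fst + 2 * η * inner ℝ ξ ζ := by
    intro ξ ζ
    have e : A ξ = WithLp.toLp 2 (Z (ξ.fst - ξ.snd) + S ξ.fst, -Z (ξ.fst - ξ.snd)) +
      (2 * η) • ξ := rfl
    rw [e, inner_add_left, inner_smul_left, WithLp.prod_inner_apply]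
    simp only [inner_add_left, inner_sub_right, inner_neg_left, RCLike.conj_to_real]
    change _ = inner ℝ (Z (ξ.fst - ξ.snd)) ζ.ofLp.1 - inner ℝ (Z (ξ.fst - ξ.snd)) ζ.ofLp.2 +
      inner ℝ (S ξ.fst) ζ.ofLp.1 + _
    ring
  have hA : ∀ ξ ζ, inner ℝ (A ξ) ζ = inner ℝ ξ (A ζ) := by
    intro ξ ζ
    rw [hAin, real_inner_comm (A ζ), hAin, hZ, hS, real_inner_comm ζ ξ,
      real_inner_comm (ξ.fst - ξ.snd), real_inner_comm ξ.fst]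
  let G₁ : E → ℝ := fun a => u₁ (x₀ + a) - u₁ x₀ - inner ℝ p₁ a
  let G₂ : E → ℝ := fun a => u₂ (y₀ + a) - u₂ y₀ - inner ℝ p₂ a
  have hG₁ : Continuous G₁ := by fun_prop
  have hG₂ : Continuous G₂ := by fun_prop
  have hl : ∀ᶠ ξ in 𝓝 (0 : WithLp 2 (E × E)),
      G₁ ξ.fst + G₂ ξ.snd ≤ 1 / 2 * inner ℝ (A ξ) ξ - η * ‖ξ‖ ^ 2 := by
    have ht : Tendsto (WithLp.prodContinuousLinearEquiv 2 ℝ E E)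
        (𝓝 0) (𝓝 0) := by
      simpa using (WithLp.prodContinuousLinearEquiv 2 ℝ E E).continuous.tendsto 0
    filter_upwards [ht.eventually hloc] with ξ hξ
    rw [hAin, real_inner_self_eq_norm_sq]
    change u₁ (x₀ + ξ.fst) + u₂ (y₀ + ξ.snd) ≤ u₁ x₀ + u₂ y₀ + inner ℝ p₁ ξ.fst +
      inner ℝ p₂ ξ.snd + 1 / 2 * inner ℝ (Z (ξ.fst - ξ.snd)) (ξ.fst - ξ.snd) +
      1 / 2 * inner ℝ (S ξ.fst) ξ.fst at hξ
    simp only [G₁, G₂]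
    linarith
  obtain ⟨z₁, z₂, P₁, P₂, X₁, X₂, hz₁, hz₂, hP₁, hP₂, hX₁, hX₂, hj₁, hj₂, hX⟩ :=
    exists_jets_of_strict_max hG₁ hG₂ (by simp [G₁]) (by simp [G₂]) hA hη0 hl
      (by positivity : 0 < δ / 2)
  refine ⟨x₀ + z₁, y₀ + z₂, p₁ + P₁, p₂ + P₂, X₁, X₂, ?_, ?_, ?_, ?_, hX₁, hX₂, ?_, ?_, ?_⟩
  · simp; linarith
  · simp; linarith
  · simp; linarith
  · simp; linarith
  · filter_upwards [hj₁] with a ha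
    simp only [G₁, inner_add_right] at ha
    rw [add_assoc, inner_add_left]
    linarith
  · filter_upwards [hj₂] with a ha
    simp only [G₂, inner_add_right] at ha
    rw [add_assoc, inner_add_left]
    linarith
  · intro a b
    have h := hX a b
    rw [hAin, real_inner_self_eq_norm_sq, WithLp.prod_norm_sq_eq_of_L2] at h
    simp only [WithLp.toLp_fst, WithLp.toLp_snd] at h
    have e : δ = 4 * η := by rw [hη]; ring
    rw [e] at h ⊢
    linarith

end TheoremOnSums

section ViscosityJets

variable {n : ℕ}

/-- The matrix of the quadratic form `a ↦ ⟪X a, a⟫` in the standard basis. -/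
def formMatrix (X : En n →L[ℝ] En n) : Mat n :=
  Matrix.of fun i j => inner ℝ (X (EuclideanSpace.single i 1)) (EuclideanSpace.single j 1)

theorem formMatrix_isSymm {X : En n →L[ℝ] En n}
    (hX : ∀ a b, inner ℝ (X a) b = inner ℝ a (X b)) : (formMatrix X).IsSymm := by
  ext i j
  simp only [formMatrix, Matrix.transpose_apply, Matrix.of_apply]
  rw [hX, real_inner_comm]

theorem formMatrix_sub (X Y : En n →L[ℝ] En n) :
    formMatrix (X - Y) = formMatrix X - formMatrix Y := by
  ext i j
  simp [formMatrix, inner_sub_left]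

/-- The quadratic polynomial with gradient `P` and Hessian `X` at `x`. -/
def quadPoly (P : En n) (X : En n →L[ℝ] En n) (x : En n) : En n → ℝ :=
  fun z => inner ℝ P (z - x) + 1 / 2 * inner ℝ (X (z - x)) (z - x)

theorem contDiff_quadPoly (P : En n) (X : En n →L[ℝ] En n) (x : En n) :
    ContDiff ℝ 2 (quadPoly P X x) := by
  have h : ContDiff ℝ 2 fun z : En n => z - x := by fun_prop
  exact (contDiff_const.inner ℝ h).add (contDiff_const.mul ((X.contDiff.comp h).inner ℝ h))

theorem fderiv_quadPoly (P : En n) {X : En n →L[ℝ] En n}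
    (hX : ∀ a b, inner ℝ (X a) b = inner ℝ a (X b)) (x z : En n) :
    fderiv ℝ (quadPoly P X x) z = innerSL ℝ (P + X (z - x)) := by
  have h1 : HasFDerivAt (fun z : En n => z - x) (ContinuousLinearMap.id ℝ (En n)) z :=
    (hasFDerivAt_id z).sub_const x
  have h2 := (X.hasFDerivAt.comp z h1).inner ℝ h1
  have h3 := (innerSL ℝ P).hasFDerivAt.comp z h1
  have h4 := h3.add (h2.const_mul (1 / 2))
  have h5 : HasFDerivAt (quadPoly P X x) _ z := h4
  rw [h5.fderiv]
  ext a
  have h6 : inner ℝ (z - x) (X a) = inner ℝ (X z - X x) a := by rw [← hX, map_sub]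
  simp only [Function.comp_apply, map_sub, _root_.add_apply, _root_.sub_apply, _root_.smul_apply,
    ContinuousLinearMap.comp_apply, ContinuousLinearMap.id_apply, fderivInnerCLM_apply,
    ContinuousLinearMap.prod_apply, smul_eq_mul, innerSL_apply_apply, map_add]
  rw [real_inner_comm (z - x), h6]
  simp only [inner_sub_left]
  ring

theorem hess_quadPoly (P : En n) {X : En n →L[ℝ] En n}
    (hX : ∀ a b, inner ℝ (X a) b = inner ℝ a (X b)) (x z : En n) :
    hess n (quadPoly P X x) z = formMatrix X := by
  ext i j
  simp only [hess, formMatrix, Matrix.of_apply, fderiv_quadPoly P hX]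
  have h1 : HasFDerivAt (fun z : En n => z - x) (ContinuousLinearMap.id ℝ (En n)) z :=
    (hasFDerivAt_id z).sub_const x
  have h2 := (X.hasFDerivAt.comp z h1).const_add P
  have h3 := h2.inner ℝ (hasFDerivAt_const (EuclideanSpace.single j (1 : ℝ)) z)
  have h4 : HasFDerivAt (fun z => innerSL ℝ (P + X (z - x)) (EuclideanSpace.single j (1 : ℝ))) _ z := h3
  rw [h4.fderiv]
  simp [fderivInnerCLM_apply]

theorem ViscSubE.le_of_jet {F : Mat n → ℝ} {v u : En n → ℝ}
    (hu : ViscSubE n univ (Fop n F 0 v) u) {x P : En n} {X : En n →L[ℝ] En n}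
    (hX : ∀ a b, inner ℝ (X a) b = inner ℝ a (X b))
    (hj : ∀ᶠ a in 𝓝 (0 : En n), u (x + a) ≤ u x + inner ℝ P a + 1 / 2 * inner ℝ (X a) a) :
    F (formMatrix X) - 1 / 2 * inner ℝ P x ≤ v x := by
  have ht : Tendsto (fun z => z - x) (𝓝 x) (𝓝 0) := by
    have : Continuous fun z : En n => z - x := by fun_prop
    simpa using this.tendsto x
  have hmax : IsLocalMaxOn (fun z => u z - quadPoly P X x z) univ x := by
    rw [isLocalMaxOn_univ_iff]
    filter_upwards [ht.eventually hj] with z hz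
    simp only [add_sub_cancel] at hz
    simp only [quadPoly, sub_self, map_zero, inner_zero_right]
    linarith
  have h := hu x (mem_univ x) _ (contDiff_quadPoly P X x) hmax
  rw [hess_quadPoly P hX, fderiv_quadPoly P hX] at h
  simp only [Fop, sub_self, map_zero, add_zero, innerSL_apply_apply] at h
  linarith

theorem ViscSupE.le_of_jet {F : Mat n → ℝ} {v u : En n → ℝ}
    (hu : ViscSupE n univ (Fop n F 0 v) u) {x P : En n} {X : En n →L[ℝ] En n}
    (hX : ∀ a b, inner ℝ (X a) b = inner ℝ a (X b))
    (hj : ∀ᶠ a in 𝓝 (0 : En n), -u (x + a) ≤ -u x + inner ℝ P a + 1 / 2 * inner ℝ (X a) a) :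
    v x ≤ F (formMatrix (-X)) + 1 / 2 * inner ℝ P x := by
  have hX' : ∀ a b, inner ℝ ((-X) a) b = inner ℝ a ((-X) b) := fun a b => by simp [hX]
  have ht : Tendsto (fun z => z - x) (𝓝 x) (𝓝 0) := by
    have : Continuous fun z : En n => z - x := by fun_prop
    simpa using this.tendsto x
  have hmin : IsLocalMinOn (fun z => u z - quadPoly (-P) (-X) x z) univ x := by
    rw [isLocalMinOn_univ_iff]
    filter_upwards [ht.eventually hj] with z hz
    simp only [add_sub_cancel] at hz
    simp only [quadPoly, sub_self, map_zero, inner_zero_right, _root_.neg_apply, inner_neg_left]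
    linarith
  have h := hu x (mem_univ x) _ (contDiff_quadPoly (-P) (-X) x) hmin
  rw [hess_quadPoly (-P) hX', fderiv_quadPoly (-P) hX'] at h
  simp only [Fop, sub_self, map_zero, add_zero, innerSL_apply_apply, inner_neg_left] at h
  linarith

/-- At a local maximum of `u x - w y` minus a quadratic polynomial, the equations of a viscosity
subsolution `u` and a supersolution `w` can be compared. -/
theorem exists_forms_of_local_max {F : Mat n → ℝ} {v v' u w : En n → ℝ}
    (hv : Continuous v) (hv' : Continuous v') (huc : Continuous u) (hwc : Continuous w)
    (hu : ViscSubE n univ (Fop n F 0 v) u) (hw : ViscSupE n univ (Fop n F 0 v') w)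
    {x₀ y₀ p₁ p₂ : En n} {Z S : En n →L[ℝ] En n}
    (hZ : ∀ a b, inner ℝ (Z a) b = inner ℝ a (Z b))
    (hS : ∀ a b, inner ℝ (S a) b = inner ℝ a (S b))
    (hloc : ∀ᶠ h in 𝓝 (0 : En n × En n), u (x₀ + h.1) - w (y₀ + h.2) ≤
      u x₀ - w y₀ + inner ℝ p₁ h.1 + inner ℝ p₂ h.2 +
        1 / 2 * inner ℝ (Z (h.1 - h.2)) (h.1 - h.2) + 1 / 2 * inner ℝ (S h.1) h.1)
    {η : ℝ} (hη : 0 < η) :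
    ∃ X₁ X₂ : En n →L[ℝ] En n, (∀ a b, inner ℝ (X₁ a) b = inner ℝ a (X₁ b)) ∧
      (∀ a b, inner ℝ (X₂ a) b = inner ℝ a (X₂ b)) ∧
      (∀ a b, inner ℝ (X₁ a) a + inner ℝ (X₂ b) b ≤
        inner ℝ (Z (a - b)) (a - b) + inner ℝ (S a) a + η * (‖a‖ ^ 2 + ‖b‖ ^ 2)) ∧
      F (formMatrix X₁) - F (formMatrix (-X₂)) ≤
        v x₀ - v' y₀ + 1 / 2 * inner ℝ p₁ x₀ + 1 / 2 * inner ℝ p₂ y₀ + η := by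
  let Θ : En n × En n × En n × En n → ℝ := fun q =>
    v q.1 - v' q.2.1 + 1 / 2 * inner ℝ q.2.2.1 q.1 + 1 / 2 * inner ℝ q.2.2.2 q.2.1
  have hΘ : Continuous Θ := by fun_prop
  obtain ⟨δ, hδ, hball⟩ := Metric.continuous_iff.1 hΘ (x₀, y₀, p₁, p₂) η hη
  have hm : 0 < min δ η := lt_min hδ hη
  obtain ⟨x, y, P₁, P₂, X₁, X₂, hx, hy, hP₁, hP₂, hX₁, hX₂, hj₁, hj₂, hX⟩ :=
    exists_jets_of_local_max (u₁ := u) (u₂ := fun z => -w z) huc hwc.neg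
      (x₀ := x₀) (y₀ := y₀) (p₁ := p₁) (p₂ := p₂) hZ hS
      (by filter_upwards [hloc] with h hh; linarith) hm
  refine ⟨X₁, X₂, hX₁, hX₂, fun a b => (hX a b).trans ?_, ?_⟩
  · gcongr; exact min_le_right _ _
  · have e1 := hu.le_of_jet hX₁ hj₁
    have e2 := hw.le_of_jet hX₂ hj₂
    have e3 := hball (x, y, P₁, P₂) (by
      simp only [Prod.dist_eq, max_lt_iff]
      have := min_le_left δ η
      refine ⟨?_, ?_, ?_, ?_⟩ <;> linarith)
    rw [Real.dist_eq] at e3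
    have e4 := (abs_lt.1 e3).2
    simp only [Θ] at e4
    linarith

end ViscosityJets

section Pucci

variable {n : ℕ} {lam Lam : ℝ}

theorem exists_basis_trace_mul_formMatrix {A : Mat n} (hA : A ∈ PucciMatrices n lam Lam) :
    ∃ (b : OrthonormalBasis (Fin n) ℝ (En n)) (μ : Fin n → ℝ), (∀ k, μ k ∈ Icc lam Lam) ∧
      ∀ X : En n →L[ℝ] En n, (A * formMatrix X).trace = ∑ k, μ k * inner ℝ (X (b k)) (b k) := by
  obtain ⟨hH, hμ⟩ := hA
  refine ⟨hH.eigenvectorBasis, hH.eigenvalues, hμ, fun X => ?_⟩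
  let T : En n →ₗ[ℝ] En n := (X : En n →ₗ[ℝ] En n) ∘ₗ Matrix.toEuclideanLin A
  have h1 := LinearMap.trace_eq_sum_inner T hH.eigenvectorBasis
  have h2 := LinearMap.trace_eq_sum_inner T (EuclideanSpace.basisFun (Fin n) ℝ)
  have h3 : ∀ k, Matrix.toEuclideanLin A (hH.eigenvectorBasis k) =
      hH.eigenvalues k • hH.eigenvectorBasis k := by
    intro k
    rw [Matrix.toEuclideanLin, Matrix.toLpLin_apply, hH.mulVec_eigenvectorBasis]
    rfl
  have h4 : ∀ j, Matrix.toEuclideanLin A (EuclideanSpace.single j 1) =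
      ∑ i, A i j • EuclideanSpace.single i (1 : ℝ) := by
    intro j
    ext k
    simp [Matrix.toEuclideanLin, Matrix.toLpLin_apply, Finset.sum_apply, Pi.single_apply]
  have h5 : ∀ i j, A i j = A j i := fun i j => by simpa using (hH.apply i j).symm
  calc (A * formMatrix X).trace
      = ∑ j, inner ℝ (EuclideanSpace.basisFun (Fin n) ℝ j)
          (T (EuclideanSpace.basisFun (Fin n) ℝ j)) := by
        simp only [Matrix.trace, Matrix.diag_apply, Matrix.mul_apply, formMatrix, Matrix.of_apply,
          EuclideanSpace.basisFun_apply, T, LinearMap.comp_apply, h4, map_sum, map_smul,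
          ContinuousLinearMap.coe_coe, inner_sum, inner_smul_right]
        refine Finset.sum_congr rfl fun j _ => Finset.sum_congr rfl fun i _ => ?_
        rw [h5 i j, real_inner_comm]
    _ = ∑ k, inner ℝ (hH.eigenvectorBasis k) (T (hH.eigenvectorBasis k)) := by rw [← h2, h1]
    _ = _ := by
        refine Finset.sum_congr rfl fun k _ => ?_
        rw [real_inner_comm]
        simp only [T, LinearMap.comp_apply, h3, map_smul, ContinuousLinearMap.coe_coe,
          inner_smul_left, RCLike.conj_to_real]

theorem pucciMatrices_nonempty (h : lam ≤ Lam) : (PucciMatrices n lam Lam).Nonempty := by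
  have hH : (lam • (1 : Mat n)).IsHermitian := by
    ext i j
    simp [Matrix.one_apply, eq_comm]
  refine ⟨lam • 1, hH, fun i => ?_⟩
  have h1 := hH.mulVec_eigenvectorBasis i
  rw [Matrix.smul_mulVec, Matrix.one_mulVec] at h1
  have h2 : lam • hH.eigenvectorBasis i = hH.eigenvalues i • hH.eigenvectorBasis i := by
    ext k; exact congrFun h1 k
  have h3 : hH.eigenvectorBasis i ≠ 0 := hH.eigenvectorBasis.orthonormal.ne_zero i
  rw [← smul_left_injective ℝ h3 h2]
  exact ⟨le_rfl, h⟩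

theorem UniformlyElliptic.le_sub_of_forall {F : Mat n → ℝ} (hF : UniformlyElliptic n lam Lam F)
    (h : lam ≤ Lam) {X Y : En n →L[ℝ] En n}
    (hX : ∀ a b, inner ℝ (X a) b = inner ℝ a (X b))
    (hY : ∀ a b, inner ℝ (Y a) b = inner ℝ a (Y b)) {κ : ℝ}
    (hκ : ∀ (b : OrthonormalBasis (Fin n) ℝ (En n)) (μ : Fin n → ℝ), (∀ k, μ k ∈ Icc lam Lam) →
      ∑ k, μ k * inner ℝ ((X - Y) (b k)) (b k) ≤ -κ) :
    κ ≤ F (formMatrix X) - F (formMatrix Y) := by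
  refine le_trans ?_ (hF _ _ (formMatrix_isSymm hX) (formMatrix_isSymm hY)).1
  rw [← formMatrix_sub]
  refine le_csInf ((pucciMatrices_nonempty h).image _) ?_
  rintro _ ⟨A, hA, rfl⟩
  obtain ⟨b, μ, hμ, htr⟩ := exists_basis_trace_mul_formMatrix hA
  have := hκ b μ hμ
  simp only [htr]
  linarith

theorem sum_mul_inner_le (hlam : 0 ≤ lam) (Y : En n →L[ℝ] En n) {t K : ℝ}
    (ht : 0 ≤ t) (hY : ∀ a, inner ℝ (Y a) a ≤ t * ‖a‖ ^ 2) {e : En n} (he : ‖e‖ = 1)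
    (hYe : inner ℝ (Y e) e ≤ -K) (b : OrthonormalBasis (Fin n) ℝ (En n)) {μ : Fin n → ℝ}
    (hμ : ∀ k, μ k ∈ Icc lam Lam) :
    ∑ k, μ k * inner ℝ (Y (b k)) (b k) ≤ -(lam * K) + n * Lam * t := by
  have hn : Nonempty (Fin n) := by
    by_contra hn
    have : IsEmpty (Fin n) := not_nonempty_iff.1 hn
    have : e = 0 := Subsingleton.elim _ _
    simp [this] at he
  obtain ⟨i₀⟩ := hn
  have hon : Orthonormal ℝ (({i₀} : Set (Fin n)).domRestrict fun _ => e) := by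
    refine ⟨fun i => he, fun i j hij => ?_⟩
    exact absurd (Subsingleton.elim i j) hij
  obtain ⟨c, hc⟩ := hon.exists_orthonormalBasis_extension_of_card_eq (by simp)
  have hc0 : c i₀ = e := hc i₀ rfl
  have hb : ∀ k, inner ℝ (Y (b k)) (b k) ≤ t := fun k => by simpa using hY (b k)
  have htr : ∑ k, inner ℝ (Y (b k)) (b k) ≤ -K + n * t := by
    have h1 := LinearMap.trace_eq_sum_inner (Y : En n →ₗ[ℝ] En n) b
    have h2 := LinearMap.trace_eq_sum_inner (Y : En n →ₗ[ℝ] En n) c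
    calc ∑ k, inner ℝ (Y (b k)) (b k) = ∑ k, inner ℝ (Y (c k)) (c k) := by
          simp only [real_inner_comm (b _), real_inner_comm (c _)]
          exact h1.symm.trans h2
      _ ≤ ∑ k, (t + if k = i₀ then -K else 0) := by
          refine Finset.sum_le_sum fun k _ => ?_
          split_ifs with hk
          · rw [hk, hc0]; linarith
          · simpa using hY (c k)
      _ = _ := by simp [Finset.sum_add_distrib]; ring
  calc ∑ k, μ k * inner ℝ (Y (b k)) (b k)
      ≤ ∑ k, (lam * inner ℝ (Y (b k)) (b k) + (Lam - lam) * t) := by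
        refine Finset.sum_le_sum fun k _ => ?_
        have h1 := (hμ k).1
        have h2 := (hμ k).2
        nlinarith [mul_nonneg (sub_nonneg.2 h1) (sub_nonneg.2 (hb k)),
          mul_nonneg (sub_nonneg.2 h2) ht]
    _ = lam * ∑ k, inner ℝ (Y (b k)) (b k) + n * ((Lam - lam) * t) := by
        simp [Finset.sum_add_distrib, Finset.mul_sum]
    _ ≤ _ := by nlinarith [mul_le_mul_of_nonneg_left htr hlam]

end Pucci

section Maximum

variable {E : Type*} [NormedAddCommGroup E] [ProperSpace E]

theorem exists_radius_abs_lt {f : E → ℝ} (hf : Tendsto f (cocompact E) (𝓝 0)) {m : ℝ}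
    (hm : 0 < m) : ∃ R, ∀ y, R < ‖y‖ → |f y| < m := by
  have h1 : ∀ᶠ y in cocompact E, |f y| < m := by
    filter_upwards [hf.eventually (Metric.ball_mem_nhds (0 : ℝ) hm)] with y hy
    simpa using hy
  rw [← Metric.cobounded_eq_cocompact] at h1
  obtain ⟨R, -, hR⟩ := (hasBasis_cobounded_norm.eventually_iff).1 h1
  exact ⟨R, fun y hy => hR hy.le⟩

theorem exists_max_of_tendsto_zero {u w : E → ℝ} (huc : Continuous u) (hwc : Continuous w)
    (hu : Tendsto u (cocompact E) (𝓝 0)) (hw : Tendsto w (cocompact E) (𝓝 0)) {δ : ℝ}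
    {φ : E → E → ℝ} (hφ : Continuous fun q : E × E => φ q.1 q.2)
    (hφ0 : ∀ x y, dist x y ≤ δ → 0 ≤ φ x y) {x₁ y₁ : E} (h₁ : dist x₁ y₁ ≤ δ)
    (hpos : 0 < u x₁ - w y₁ - φ x₁ y₁) :
    ∃ x₀ y₀, dist x₀ y₀ ≤ δ ∧
      ∀ x y, dist x y ≤ δ → u x - w y - φ x y ≤ u x₀ - w y₀ - φ x₀ y₀ := by
  set m := u x₁ - w y₁ - φ x₁ y₁ with hm
  obtain ⟨R₁, hR₁⟩ := exists_radius_abs_lt hu (half_pos hpos)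
  obtain ⟨R₂, hR₂⟩ := exists_radius_abs_lt hw (half_pos hpos)
  set R := max R₁ R₂ + δ with hR
  have hδ : 0 ≤ δ := dist_nonneg.trans h₁
  have hbd : ∀ x y, dist x y ≤ δ → m ≤ u x - w y - φ x y → ‖x‖ ≤ R ∧ ‖y‖ ≤ R := by
    intro x y hxy hge
    have h0 := hφ0 x y hxy
    rw [dist_eq_norm] at hxy
    have hx : ‖x‖ ≤ ‖y‖ + δ := by
      have := norm_add_le (x - y) y
      rw [sub_add_cancel] at this
      linarith
    have hy : ‖y‖ ≤ ‖x‖ + δ := by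
      have := norm_sub_le x (x - y)
      rw [sub_sub_cancel] at this
      linarith
    have hl := le_max_left R₁ R₂
    have hr := le_max_right R₁ R₂
    by_cases hx1 : ‖x‖ ≤ R₁
    · constructor <;> linarith
    · by_cases hy1 : ‖y‖ ≤ R₂
      · constructor <;> linarith
      · have a1 := abs_lt.1 (hR₁ x (not_le.1 hx1))
        have a2 := abs_lt.1 (hR₂ y (not_le.1 hy1))
        linarith [a1.2, a2.1]
  let S : Set (E × E) :=
    (Metric.closedBall 0 R ×ˢ Metric.closedBall 0 R) ∩ {q | dist q.1 q.2 ≤ δ}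
  have hS : IsCompact S :=
    ((isCompact_closedBall (0 : E) R).prod (isCompact_closedBall 0 R)).inter_right
      (isClosed_le (continuous_fst.dist continuous_snd) continuous_const)
  have hmem : ∀ x y, dist x y ≤ δ → m ≤ u x - w y - φ x y → (x, y) ∈ S := by
    intro x y hxy hge
    obtain ⟨hx, hy⟩ := hbd x y hxy hge
    exact ⟨⟨by simpa using hx, by simpa using hy⟩, hxy⟩
  obtain ⟨⟨x₀, y₀⟩, ⟨-, h₀⟩, hmax⟩ := hS.exists_isMaxOn
    (f := fun q : E × E => u q.1 - w q.2 - φ q.1 q.2) ⟨_, hmem x₁ y₁ h₁ le_rfl⟩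
    (by fun_prop)
  refine ⟨x₀, y₀, h₀, fun x y hxy => ?_⟩
  by_cases hge : m ≤ u x - w y - φ x y
  · exact hmax (hmem x y hxy hge)
  · exact (not_le.1 hge).le.trans (hmax (hmem x₁ y₁ h₁ le_rfl))

end Maximum

section Comparison

variable {n : ℕ} {lam Lam b : ℝ}

theorem gaussian_taylor {E : Type*} [NormedAddCommGroup E] [InnerProductSpace ℝ E] {b : ℝ}
    (hb : 0 ≤ b) (x : E) {ε : ℝ} (hε : 0 < ε) :
    ∀ᶠ a in 𝓝 (0 : E), Real.exp (-(b * ‖x + a‖ ^ 2)) ≤ Real.exp (-(b * ‖x‖ ^ 2)) *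
      (1 - 2 * b * inner ℝ x a - b * ‖a‖ ^ 2 + 2 * b ^ 2 * (inner ℝ x a) ^ 2) + ε * ‖a‖ ^ 2 := by
  set L := 2 * b * ‖x‖ + b with hL
  have hL0 : 0 ≤ L := by positivity
  set C := L ^ 3 + 2 * b * L with hC
  have hC0 : 0 ≤ C := by positivity
  have hsmall : ∀ᶠ a in 𝓝 (0 : E), ‖a‖ < 1 ∧ L * ‖a‖ < 1 ∧ C * ‖a‖ < ε := by
    have h1 : ∀ K κ : ℝ, 0 < κ → ∀ᶠ a in 𝓝 (0 : E), K * ‖a‖ < κ := by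
      intro K κ hκ
      have : ContinuousAt (fun a : E => K * ‖a‖) 0 := by fun_prop
      exact this.eventually_lt continuousAt_const (by simpa using hκ)
    filter_upwards [h1 1 1 one_pos, h1 L 1 one_pos, h1 C ε hε] with a h1 h2 h3
    exact ⟨by linarith, h2, h3⟩
  filter_upwards [hsmall] with a ⟨ha1, ha2, ha3⟩
  set r := ‖a‖ with hr
  have hr0 : 0 ≤ r := norm_nonneg a
  set i : ℝ := inner ℝ x a with hi
  have hi1 : |i| ≤ ‖x‖ * r := abs_real_inner_le_norm x a
  set s := -(2 * b * i + b * r ^ 2) with hs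
  have hsL : |s| ≤ L * r := by
    rw [hs, abs_neg]
    calc |2 * b * i + b * r ^ 2| ≤ |2 * b * i| + |b * r ^ 2| := abs_add_le _ _
      _ = 2 * b * |i| + b * r ^ 2 := by
        rw [abs_mul, abs_of_nonneg (by positivity : 0 ≤ 2 * b),
          abs_of_nonneg (by positivity : 0 ≤ b * r ^ 2)]
      _ ≤ 2 * b * (‖x‖ * r) + b * r := by
        have : r ^ 2 ≤ r := by nlinarith
        gcongr
      _ = L * r := by rw [hL]; ring
  have hexp := Real.exp_bound (x := s) (by linarith) (n := 3) (by norm_num)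
  have hexp2 := (abs_le.1 hexp).2
  norm_num [Finset.sum_range_succ, Nat.factorial] at hexp2
  have hs3 : |s| ^ 3 ≤ L ^ 3 * r ^ 3 := by
    rw [← mul_pow]; gcongr
  have hs2 : s ^ 2 ≤ 4 * b ^ 2 * i ^ 2 + 4 * b * L * r ^ 3 := by
    have e1 : s ^ 2 - 4 * b ^ 2 * i ^ 2 = b * r ^ 2 * (4 * b * i + b * r ^ 2) := by rw [hs]; ring
    have e2 : 4 * b * i + b * r ^ 2 ≤ 4 * (L * r) := by
      have e3 : i ≤ ‖x‖ * r := (le_abs_self i).trans hi1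
      have e4 : r ^ 2 ≤ r := by nlinarith
      rw [hL]
      nlinarith [mul_le_mul_of_nonneg_left e3 hb, mul_le_mul_of_nonneg_left e4 hb,
        mul_nonneg hb (mul_nonneg (norm_nonneg x) hr0), mul_nonneg hb hr0]
    have e5 := mul_le_mul_of_nonneg_left e2 (by positivity : 0 ≤ b * r ^ 2)
    nlinarith
  have hmain : Real.exp s ≤ 1 - 2 * b * i - b * r ^ 2 + 2 * b ^ 2 * i ^ 2 + C * r ^ 3 := by
    have : 0 ≤ L ^ 3 * r ^ 3 := by positivity
    rw [hC]
    nlinarith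
  have hfac : Real.exp (-(b * ‖x + a‖ ^ 2)) = Real.exp (-(b * ‖x‖ ^ 2)) * Real.exp s := by
    rw [← Real.exp_add, norm_add_sq_real]
    congr 1
    rw [hs]; ring
  have hle1 : Real.exp (-(b * ‖x‖ ^ 2)) ≤ 1 := Real.exp_le_one_iff.2 (by
    have : 0 ≤ b * ‖x‖ ^ 2 := by positivity
    linarith)
  have hrr : C * r ^ 3 ≤ ε * r ^ 2 := by nlinarith [sq_nonneg r]
  rw [hfac]
  have h1 := mul_le_mul_of_nonneg_left hmain (Real.exp_pos (-(b * ‖x‖ ^ 2))).le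
  have h2 : Real.exp (-(b * ‖x‖ ^ 2)) * (C * r ^ 3) ≤ C * r ^ 3 :=
    mul_le_of_le_one_left (by positivity) hle1
  nlinarith

/-- The inequality satisfied at a local maximum of `u x - w y - N |x - y|² - C exp (-b |x|²)`. -/
theorem gaussian_le_of_local_max (hlam : 0 < lam) (hLam : lam ≤ Lam) {F : Mat n → ℝ}
    (hF : UniformlyElliptic n lam Lam F) (hb : 0 < b) (hbL : 8 * Lam * b ≤ 1)
    {v v' u w : En n → ℝ} (hv : Continuous v) (hv' : Continuous v')
    (huc : Continuous u) (hwc : Continuous w)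
    (hu : ViscSubE n univ (Fop n F 0 v) u) (hw : ViscSupE n univ (Fop n F 0 v') w)
    {N C Ψ : ℝ} (hC : 0 < C) {x₀ y₀ : En n} (hΨ : Ψ = C * Real.exp (-(b * ‖x₀‖ ^ 2)))
    (hmax : ∀ᶠ h in 𝓝 (0 : En n × En n), u (x₀ + h.1) - w (y₀ + h.2) -
      (N * ‖x₀ + h.1 - (y₀ + h.2)‖ ^ 2 + C * Real.exp (-(b * ‖x₀ + h.1‖ ^ 2))) ≤
        u x₀ - w y₀ - (N * ‖x₀ - y₀‖ ^ 2 + Ψ)) {η : ℝ} (hη0 : 0 < η) :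
    Ψ * (2 * b * (n * lam) + b / 2 * ‖x₀‖ ^ 2) ≤
      v x₀ - v' y₀ + N * ‖x₀ - y₀‖ ^ 2 + η * (1 + 4 * (n * Lam)) := by
  have hΨ0 : 0 < Ψ := hΨ ▸ mul_pos hC (Real.exp_pos _)
  obtain ⟨S, hSin⟩ : ∃ S : En n →L[ℝ] En n, ∀ a h, inner ℝ (S a) h =
      (-(2 * b * Ψ) + 2 * η) * inner ℝ a h + 4 * b ^ 2 * Ψ * (inner ℝ x₀ a * inner ℝ x₀ h) :=
    ⟨(-(2 * b * Ψ) + 2 * η) • ContinuousLinearMap.id ℝ (En n) +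
      (4 * b ^ 2 * Ψ) • (innerSL ℝ x₀).smulRight x₀, fun a h => by
        simp [inner_add_left, inner_smul_left]⟩
  obtain ⟨Z, hZin⟩ : ∃ Z : En n →L[ℝ] En n, ∀ a h, inner ℝ (Z a) h = 2 * N * inner ℝ a h :=
    ⟨(2 * N) • ContinuousLinearMap.id ℝ (En n), fun a h => by simp [inner_smul_left]⟩
  have hloc : ∀ᶠ h in 𝓝 (0 : En n × En n), u (x₀ + h.1) - w (y₀ + h.2) ≤ u x₀ - w y₀ +
      inner ℝ ((2 * N) • (x₀ - y₀) - (2 * b * Ψ) • x₀) h.1 +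
      inner ℝ (-((2 * N) • (x₀ - y₀))) h.2 +
      1 / 2 * inner ℝ (Z (h.1 - h.2)) (h.1 - h.2) + 1 / 2 * inner ℝ (S h.1) h.1 := by
    have ht : Tendsto (fun h : En n × En n => h.1) (𝓝 0) (𝓝 0) := continuous_fst.tendsto 0
    filter_upwards [hmax, ht.eventually
      (gaussian_taylor hb.le x₀ (by positivity : 0 < η / C))] with h h1 hg
    have h2 := mul_le_mul_of_nonneg_left hg hC.le
    rw [mul_add, ← mul_assoc, ← mul_assoc, ← hΨ, mul_div_cancel₀ _ hC.ne'] at h2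
    have h4 : ‖x₀ + h.1 - (y₀ + h.2)‖ ^ 2 = ‖x₀ - y₀‖ ^ 2 +
        2 * (inner ℝ (x₀ - y₀) h.1 - inner ℝ (x₀ - y₀) h.2) + ‖h.1 - h.2‖ ^ 2 := by
      rw [← inner_sub_right, ← norm_add_sq_real]; congr 2; abel
    rw [hSin, hZin, inner_sub_left, inner_neg_left, inner_smul_left, inner_smul_left,
      inner_smul_left, real_inner_self_eq_norm_sq, real_inner_self_eq_norm_sq]
    simp only [RCLike.conj_to_real]
    rw [h4] at h1
    linarith
  obtain ⟨X₁, X₂, hX₁, hX₂, hX, hFX⟩ := exists_forms_of_local_max hv hv' huc hwc hu hw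
    (fun a h => by rw [hZin, real_inner_comm, ← hZin, real_inner_comm])
    (fun a h => by rw [hSin, real_inner_comm (S h), hSin, real_inner_comm a h]; ring) hloc hη0
  have hκ := hF.le_sub_of_forall hLam hX₁ (Y := -X₂) (fun a h => by simp [hX₂])
    (κ := Ψ * (2 * b * (n * lam) - b / 2 * ‖x₀‖ ^ 2) - n * Lam * (4 * η)) (by
      intro e μ hμ
      have hμ0 : ∀ k, 0 ≤ μ k := fun k => hlam.le.trans (hμ k).1
      have hs1 : (n : ℝ) * lam ≤ ∑ k, μ k := by
        simpa using Finset.sum_le_sum fun k (_ : k ∈ Finset.univ) => (hμ k).1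
      have hs2 : ∑ k, μ k ≤ n * Lam := by
        simpa using Finset.sum_le_sum fun k (_ : k ∈ Finset.univ) => (hμ k).2
      have hs3 : ∑ k, μ k * inner ℝ x₀ (e k) ^ 2 ≤ Lam * ‖x₀‖ ^ 2 := by
        have h1 := e.sum_sq_norm_inner_left x₀
        simp only [Real.norm_eq_abs, sq_abs] at h1
        rw [← h1, Finset.mul_sum]
        exact Finset.sum_le_sum fun k _ => mul_le_mul_of_nonneg_right (hμ k).2 (sq_nonneg _)
      calc ∑ k, μ k * inner ℝ ((X₁ - -X₂) (e k)) (e k)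
          ≤ ∑ k, μ k * ((-(2 * b * Ψ) + 4 * η) + 4 * b ^ 2 * Ψ * inner ℝ x₀ (e k) ^ 2) := by
            refine Finset.sum_le_sum fun k _ => mul_le_mul_of_nonneg_left ?_ (hμ0 k)
            have h1 := hX (e k) (e k)
            rw [hZin, hSin] at h1
            simp only [sub_self, inner_zero_right, real_inner_self_eq_norm_sq,
              e.norm_eq_one] at h1
            simp only [sub_neg_eq_add, _root_.add_apply, inner_add_left]
            nlinarith
        _ = (-(2 * b * Ψ) + 4 * η) * ∑ k, μ k +
            4 * b ^ 2 * Ψ * ∑ k, μ k * inner ℝ x₀ (e k) ^ 2 := by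
            rw [Finset.mul_sum, Finset.mul_sum, ← Finset.sum_add_distrib]
            exact Finset.sum_congr rfl fun k _ => by ring
        _ ≤ _ := by
            have h1 := mul_le_mul_of_nonneg_left hs1 (by positivity : 0 ≤ 2 * b * Ψ)
            have h2 := mul_le_mul_of_nonneg_left hs2 (by positivity : 0 ≤ 4 * η)
            have h3 := mul_le_mul_of_nonneg_left hs3 (by positivity : 0 ≤ 4 * b ^ 2 * Ψ)
            have h4 : 4 * b ^ 2 * Ψ * (Lam * ‖x₀‖ ^ 2) ≤ Ψ * (b / 2 * ‖x₀‖ ^ 2) := by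
              have := mul_le_mul_of_nonneg_left hbL (by positivity : 0 ≤ b / 2 * Ψ * ‖x₀‖ ^ 2)
              nlinarith
            nlinarith)
  have hdrift : 1 / 2 * inner ℝ ((2 * N) • (x₀ - y₀) - (2 * b * Ψ) • x₀) x₀ +
      1 / 2 * inner ℝ (-((2 * N) • (x₀ - y₀))) y₀ = N * ‖x₀ - y₀‖ ^ 2 - b * Ψ * ‖x₀‖ ^ 2 := by
    rw [← real_inner_self_eq_norm_sq (x₀ - y₀)]
    simp only [inner_sub_left, inner_smul_left, inner_neg_left, RCLike.conj_to_real,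
        real_inner_self_eq_norm_sq, inner_sub_right]
    ring
  nlinarith

theorem sub_le_gaussian (hlam : 0 < lam) (hLam : lam ≤ Lam) {F : Mat n → ℝ}
    (hF : UniformlyElliptic n lam Lam F) (hb : 0 < b) (hbL : 8 * Lam * b ≤ 1)
    {v v' u w : En n → ℝ} (hv : Continuous v) (hv' : Continuous v')
    (huc : Continuous u) (hwc : Continuous w)
    (hv'0 : Tendsto v' (cocompact (En n)) (𝓝 0)) (hu0 : Tendsto u (cocompact (En n)) (𝓝 0))
    (hw0 : Tendsto w (cocompact (En n)) (𝓝 0)) {Mu Mw : ℝ} (hMu : ∀ y, |u y| ≤ Mu)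
    (hMw : ∀ y, |w y| ≤ Mw)
    (hu : ViscSubE n univ (Fop n F 0 v) u) (hw : ViscSupE n univ (Fop n F 0 v') w)
    {c C D : ℝ} (hc0 : 0 < c) (hc1 : c ≤ 2 * b * (n * lam)) (hc2 : c ≤ b / 2) (hD : 0 ≤ D)
    (hCD : D < C * c)
    (hvv : ∀ y, v y - v' y ≤ D * (1 + ‖y‖ ^ 2) * Real.exp (-(b * ‖y‖ ^ 2))) (z : En n) :
    u z - w z ≤ C * Real.exp (-(b * ‖z‖ ^ 2)) := by
  by_contra! hz
  obtain ⟨φ, hφdef⟩ : ∃ φ : En n → ℝ, ∀ y, φ y = Real.exp (-(b * ‖y‖ ^ 2)) :=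
    ⟨fun y => Real.exp (-(b * ‖y‖ ^ 2)), fun _ => rfl⟩
  simp only [← hφdef] at hz hvv
  have hφpos : ∀ y, 0 < φ y := fun y => hφdef y ▸ Real.exp_pos _
  have hφc : Continuous φ := by
    rw [funext hφdef]; fun_prop
  have hC : 0 < C := by
    by_contra! h
    nlinarith
  have hLam0 : 0 < Lam := hlam.trans_le hLam
  set m := u z - w z - C * φ z with hm
  have hm0 : 0 < m := sub_pos.2 hz
  obtain ⟨R₁, hR₁⟩ := exists_radius_abs_lt hu0 (half_pos hm0)
  obtain ⟨R₂, hR₂⟩ := exists_radius_abs_lt hw0 (half_pos hm0)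
  set R := max R₁ R₂ + 1 with hR
  set θ := (C * c - D) * Real.exp (-(b * R ^ 2)) with hθ
  have hθ0 : 0 < θ := mul_pos (by linarith) (Real.exp_pos _)
  obtain ⟨δ₁, hδ₁, hw1⟩ := Metric.uniformContinuous_iff.1
    (hwc.uniformContinuous_of_tendsto_cocompact hw0) (θ / 8) (by positivity)
  obtain ⟨δ₂, hδ₂, hv1⟩ := Metric.uniformContinuous_iff.1
    (hv'.uniformContinuous_of_tendsto_cocompact hv'0) (θ / 8) (by positivity)
  set δ := min (min δ₁ δ₂) 1 / 2 with hδ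
  have hδ0 : 0 < δ := by positivity
  have hδδ₁ : δ < δ₁ := by
    have h1 := min_le_left (min δ₁ δ₂) 1
    have h2 := min_le_left δ₁ δ₂
    linarith
  have hδδ₂ : δ < δ₂ := by
    have h1 := min_le_left (min δ₁ δ₂) 1
    have h2 := min_le_right δ₁ δ₂
    linarith
  have hδ1 : δ ≤ 1 := by
    have h1 := min_le_right (min δ₁ δ₂) 1
    linarith
  set N := (Mu + Mw + 1) / δ ^ 2 with hN
  have hMu0 : 0 ≤ Mu := (abs_nonneg _).trans (hMu 0)
  have hMw0 : 0 ≤ Mw := (abs_nonneg _).trans (hMw 0)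
  have hN0 : 0 < N := by positivity
  have hNδ : N * δ ^ 2 = Mu + Mw + 1 := by rw [hN]; field_simp
  obtain ⟨x₀, y₀, h₀, hmax⟩ := exists_max_of_tendsto_zero huc hwc hu0 hw0
    (δ := δ) (φ := fun x y => N * ‖x - y‖ ^ 2 + C * φ x) (by fun_prop)
    (fun x y _ => by have := hφpos x; positivity) (x₁ := z) (y₁ := z) (by simpa using hδ0.le)
    (by simpa using hz)
  have hval : m ≤ u x₀ - w y₀ - (N * ‖x₀ - y₀‖ ^ 2 + C * φ x₀) := by
    have := hmax z z (by simpa using hδ0.le)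
    simp only [sub_self, norm_zero] at this
    simpa [hm] using this
  have hNn : 0 ≤ N * ‖x₀ - y₀‖ ^ 2 := by positivity
  have hCφ : 0 < C * φ x₀ := mul_pos hC (hφpos _)
  have hint : dist x₀ y₀ < δ := by
    rw [dist_eq_norm]
    refine lt_of_pow_lt_pow_left₀ 2 hδ0.le ?_
    have h1 := (abs_le.1 (hMu x₀)).2
    have h2 := (abs_le.1 (hMw y₀)).1
    refine lt_of_mul_lt_mul_left ?_ hN0.le
    linarith
  have hNw : N * ‖x₀ - y₀‖ ^ 2 < θ / 8 := by
    have h1 := hmax x₀ x₀ (by simpa using hδ0.le)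
    simp only [sub_self, norm_zero] at h1
    have h2 := (abs_lt.1 (hw1 (hint.trans hδδ₁))).2
    norm_num at h1
    linarith
  have hv2 : v' x₀ - v' y₀ < θ / 8 := (abs_lt.1 (hv1 (hint.trans hδδ₂))).2
  have hx₀R : ‖x₀‖ ≤ R := by
    have hl := le_max_left R₁ R₂
    have hr := le_max_right R₁ R₂
    by_contra! hcon
    have hy : R - 1 < ‖y₀‖ := by
      have := norm_add_le (x₀ - y₀) y₀
      rw [sub_add_cancel] at this
      rw [dist_eq_norm] at hint
      linarith
    have a1 := abs_lt.1 (hR₁ x₀ (by linarith))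
    have a2 := abs_lt.1 (hR₂ y₀ (by linarith))
    linarith [a1.2, a2.1]
  set η := θ / (8 * (1 + 4 * (n * Lam))) with hη
  have hη0 : 0 < η := by positivity
  have hηle : η * (1 + 4 * (n * Lam)) = θ / 8 := by rw [hη]; field_simp
  have hnear : ∀ᶠ h : En n × En n in 𝓝 0, dist (x₀ + h.1) (y₀ + h.2) < δ := by
    have : ContinuousAt (fun h : En n × En n => dist (x₀ + h.1) (y₀ + h.2)) 0 := by
      fun_prop
    exact this.eventually_lt continuousAt_const (by simpa using hint)
  have hkey := gaussian_le_of_local_max hlam hLam hF hb hbL hv hv' huc hwc hu hw hC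
    (x₀ := x₀) (y₀ := y₀) (N := N) (Ψ := C * φ x₀) (by rw [hφdef])
    (hnear.mono fun h hh => by simpa only [← hφdef] using hmax _ _ hh.le) hη0
  have hvx := hvv x₀
  have hq : 0 ≤ ‖x₀‖ ^ 2 := sq_nonneg _
  have hlow : C * c * (1 + ‖x₀‖ ^ 2) * φ x₀ ≤
      C * φ x₀ * (2 * b * (n * lam) + b / 2 * ‖x₀‖ ^ 2) := by
    have h1 : c * (1 + ‖x₀‖ ^ 2) ≤ 2 * b * (n * lam) + b / 2 * ‖x₀‖ ^ 2 := by
      nlinarith [mul_le_mul_of_nonneg_right hc2 hq]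
    have h2 := mul_le_mul_of_nonneg_left h1 hCφ.le
    linarith
  have hθle : θ ≤ (C * c - D) * (1 + ‖x₀‖ ^ 2) * φ x₀ := by
    have h1 : Real.exp (-(b * R ^ 2)) ≤ φ x₀ := by
      rw [hφdef]
      refine Real.exp_le_exp.2 (neg_le_neg ?_)
      have := pow_le_pow_left₀ (norm_nonneg _) hx₀R 2
      gcongr
    have h2 : 0 < C * c - D := by linarith
    calc θ ≤ (C * c - D) * φ x₀ := by rw [hθ]; gcongr
      _ ≤ (C * c - D) * (1 + ‖x₀‖ ^ 2) * φ x₀ := by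
        have := mul_nonneg (mul_nonneg h2.le hq) (hφpos x₀).le
        linarith
  linarith

end Comparison

section IshiiLions

theorem norm_taylor {E : Type*} [NormedAddCommGroup E] [InnerProductSpace ℝ E] {e : E}
    (he : ‖e‖ = 1) {r : ℝ} (hr : 0 < r) {ε : ℝ} (hε : 0 < ε) :
    ∀ᶠ h in 𝓝 (0 : E), ‖r • e + h‖ ≤
      r + inner ℝ e h + (‖h‖ ^ 2 - (inner ℝ e h) ^ 2) / (2 * r) + ε * ‖h‖ ^ 2 := by
  have hsmall : ∀ᶠ h in 𝓝 (0 : E), ‖h‖ < min (r / 2) (r ^ 2 * ε) := by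
    have : ContinuousAt (fun h : E => ‖h‖) 0 := by fun_prop
    have h0 : 0 < min (r / 2) (r ^ 2 * ε) := lt_min (by positivity) (by positivity)
    exact this.eventually_lt continuousAt_const (by simpa using h0)
  filter_upwards [hsmall] with h hh
  obtain ⟨h1, h2⟩ := lt_min_iff.1 hh
  have hsq : ‖r • e + h‖ ^ 2 = r ^ 2 + 2 * r * inner ℝ e h + ‖h‖ ^ 2 := by
    rw [norm_add_sq_real, norm_smul, he, inner_smul_left, Real.norm_eq_abs, abs_of_pos hr]
    simp only [RCLike.conj_to_real]
    ring
  have ht : |inner ℝ e h| ≤ ‖h‖ := by simpa [he] using abs_real_inner_le_norm e h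
  set t : ℝ := inner ℝ e h
  set s := ‖h‖
  obtain ⟨ht1, ht2⟩ := abs_le.1 ht
  have hs : 0 ≤ s := norm_nonneg h
  have hq : 0 ≤ s ^ 2 - t ^ 2 := by nlinarith
  have hQ : 0 ≤ (s ^ 2 - t ^ 2) / (2 * r) := by positivity
  have hε2 : 0 ≤ ε * s ^ 2 := by positivity
  refine le_of_sq_le_sq ?_ (by linarith)
  rw [hsq]
  have hkey : s ^ 2 - t ^ 2 ≤ 2 * (r + t) * ((s ^ 2 - t ^ 2) / (2 * r) + ε * s ^ 2) := by
    have e1 : 2 * (r + t) * ((s ^ 2 - t ^ 2) / (2 * r) + ε * s ^ 2) =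
        (s ^ 2 - t ^ 2) + (t * (s ^ 2 - t ^ 2) / r + 2 * (r + t) * (ε * s ^ 2)) := by
      field_simp
      ring
    have e2 : -(r * ε * s ^ 2) ≤ t * (s ^ 2 - t ^ 2) / r := by
      rw [le_div_iff₀ hr]
      have e3 : s * (s ^ 2 - t ^ 2) ≤ r ^ 2 * ε * s ^ 2 :=
        mul_le_mul h2.le (by nlinarith) hq (by positivity)
      nlinarith [mul_nonneg (by linarith : 0 ≤ s + t) hq]
    have e4 : r * (ε * s ^ 2) ≤ 2 * (r + t) * (ε * s ^ 2) :=
      mul_le_mul_of_nonneg_right (by linarith) hε2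
    linarith
  nlinarith [sq_nonneg ((s ^ 2 - t ^ 2) / (2 * r) + ε * s ^ 2)]

variable {n : ℕ} {lam Lam : ℝ}

/-- The inequality satisfied at a local maximum of `u x - u y - L |x - y| + K |x - y|²` off the
diagonal. -/
theorem le_of_local_max_norm (hlam : 0 < lam) (hLam : lam ≤ Lam) {F : Mat n → ℝ}
    (hF : UniformlyElliptic n lam Lam F) {v u : En n → ℝ} (hv : Continuous v)
    (huc : Continuous u) (hu : ViscSolE n univ (Fop n F 0 v) u) {L K r : ℝ} (hL : 0 < L)
    (hK : 0 ≤ K) (hr : 0 < r) {x₀ y₀ e : En n} (he : ‖e‖ = 1) (hxy : x₀ - y₀ = r • e)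
    (hmax : ∀ᶠ h in 𝓝 (0 : En n × En n), u (x₀ + h.1) - u (y₀ + h.2) -
      (L * ‖x₀ + h.1 - (y₀ + h.2)‖ - K * ‖x₀ + h.1 - (y₀ + h.2)‖ ^ 2) ≤
        u x₀ - u y₀ - (L * r - K * r ^ 2)) {η : ℝ} (hη0 : 0 < η) :
    8 * lam * K ≤ v x₀ - v y₀ + L * r / 2 + η * (1 + 3 * lam + 2 * (n * Lam)) := by
  obtain ⟨Z, hZin⟩ : ∃ Z : En n →L[ℝ] En n, ∀ a h, inner ℝ (Z a) h =
      (L / r + η / 4 - 2 * K) * inner ℝ a h - L / r * (inner ℝ e a * inner ℝ e h) :=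
    ⟨(L / r + η / 4 - 2 * K) • ContinuousLinearMap.id ℝ (En n) -
      (L / r) • (innerSL ℝ e).smulRight e, fun a h => by
        simp [inner_sub_left, inner_smul_left]⟩
  have hloc : ∀ᶠ h in 𝓝 (0 : En n × En n), u (x₀ + h.1) - u (y₀ + h.2) ≤ u x₀ - u y₀ +
      inner ℝ ((L - 2 * K * r) • e) h.1 + inner ℝ (-((L - 2 * K * r) • e)) h.2 +
      1 / 2 * inner ℝ (Z (h.1 - h.2)) (h.1 - h.2) +
      1 / 2 * inner ℝ ((0 : En n →L[ℝ] En n) h.1) h.1 := by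
    have ht : Tendsto (fun h : En n × En n => h.1 - h.2) (𝓝 0) (𝓝 0) := by
      have : Continuous fun h : En n × En n => h.1 - h.2 := by fun_prop
      simpa using this.tendsto 0
    filter_upwards [hmax, ht.eventually
      (norm_taylor he hr (by positivity : 0 < η / (8 * L)))] with h h1 hg
    have hsub : x₀ + h.1 - (y₀ + h.2) = r • e + (h.1 - h.2) := by rw [← hxy]; abel
    have hsq : ‖r • e + (h.1 - h.2)‖ ^ 2 =
        r ^ 2 + 2 * r * inner ℝ e (h.1 - h.2) + ‖h.1 - h.2‖ ^ 2 := by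
      rw [norm_add_sq_real, norm_smul, he, inner_smul_left, Real.norm_eq_abs, abs_of_pos hr]
      simp only [RCLike.conj_to_real]
      ring
    rw [hsub, hsq] at h1
    have h2 := mul_le_mul_of_nonneg_left hg hL.le
    have h3 : inner ℝ e h.1 - inner ℝ e h.2 = inner ℝ e (h.1 - h.2) :=
      (inner_sub_right _ _ _).symm
    rw [hZin, inner_neg_left, inner_smul_left, inner_smul_left, real_inner_self_eq_norm_sq]
    simp only [RCLike.conj_to_real, _root_.zero_apply, inner_zero_left]
    have h4 : L * (r + inner ℝ e (h.1 - h.2) +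
        (‖h.1 - h.2‖ ^ 2 - inner ℝ e (h.1 - h.2) ^ 2) / (2 * r) + η / (8 * L) * ‖h.1 - h.2‖ ^ 2) =
        L * r + L * inner ℝ e (h.1 - h.2) +
        1 / 2 * (L / r * (‖h.1 - h.2‖ ^ 2 - inner ℝ e (h.1 - h.2) ^ 2)) +
        η / 8 * ‖h.1 - h.2‖ ^ 2 := by
      field_simp
    rw [h4] at h2
    have h5 : (L - 2 * K * r) * inner ℝ e h.1 + -((L - 2 * K * r) * inner ℝ e h.2) =
        (L - 2 * K * r) * inner ℝ e (h.1 - h.2) := by rw [← h3]; ring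
    linarith
  obtain ⟨X₁, X₂, hX₁, hX₂, hX, hFX⟩ := exists_forms_of_local_max hv hv huc huc hu.1 hu.2
    (fun a h => by rw [hZin, real_inner_comm (Z h), hZin, real_inner_comm a h]; ring)
    (S := 0) (fun a h => by simp) hloc hη0
  have hκ := hF.le_sub_of_forall hLam hX₁ (Y := -X₂) (fun a h => by simp [hX₂])
    (κ := lam * (8 * K - 3 * η) - n * Lam * (2 * η)) (by
      intro c μ hμ
      have hs := sum_mul_inner_le hlam.le (X₁ - -X₂) (t := 2 * η) (K := 8 * K - 3 * η)
        (by positivity) (fun a => by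
          have h1 := hX a a
          simp only [sub_self, map_zero, inner_zero_right, _root_.zero_apply,
            inner_zero_left] at h1
          simp only [sub_neg_eq_add, _root_.add_apply, inner_add_left]
          linarith) he (by
          have h1 := hX e (-e)
          rw [hZin, sub_neg_eq_add, ← two_smul ℝ e, inner_smul_right, inner_smul_left,
            inner_smul_right, real_inner_self_eq_norm_sq, norm_neg, he] at h1
          simp only [map_neg, inner_neg_neg, _root_.zero_apply, inner_zero_left,
            RCLike.conj_to_real] at h1
          simp only [sub_neg_eq_add, _root_.add_apply, inner_add_left]
          linarith) c hμ
      linarith)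
  have hdrift : 1 / 2 * inner ℝ ((L - 2 * K * r) • e) x₀ +
      1 / 2 * inner ℝ (-((L - 2 * K * r) • e)) y₀ = (L - 2 * K * r) * r / 2 := by
    rw [inner_neg_left, mul_neg, ← sub_eq_add_neg, ← mul_sub, ← inner_sub_right, hxy,
      inner_smul_left, inner_smul_right, real_inner_self_eq_norm_sq, he]
    simp only [RCLike.conj_to_real]
    ring
  have hKr : 0 ≤ K * r * r := by positivity
  nlinarith

theorem sub_le_of_solution (hlam : 0 < lam) (hLam : lam ≤ Lam) {F : Mat n → ℝ}
    (hF : UniformlyElliptic n lam Lam F) {v u : En n → ℝ} (hv : Continuous v)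
    (huc : Continuous u) (hu0 : Tendsto u (cocompact (En n)) (𝓝 0))
    (hu : ViscSolE n univ (Fop n F 0 v) u) {V m L K : ℝ} (hV : ∀ x y, v x - v y ≤ V)
    (hm : ∀ x, |u x| ≤ m) (hL : 0 < L) (hK : 0 < K) (hLK : L ^ 2 = 8 * m * K)
    (hVK : V + 2 * m < 8 * lam * K) {x y : En n} (hxy : dist x y ≤ L / (2 * K)) :
    u x - u y ≤ L * ‖x - y‖ - K * ‖x - y‖ ^ 2 := by
  by_contra! hcon
  have hnn : ∀ x y : En n, dist x y ≤ L / (2 * K) → 0 ≤ L * ‖x - y‖ - K * ‖x - y‖ ^ 2 := by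
    intro x y h
    rw [dist_eq_norm, le_div_iff₀ (by positivity)] at h
    nlinarith [norm_nonneg (x - y)]
  obtain ⟨x₀, y₀, h₀, hmax⟩ := exists_max_of_tendsto_zero huc huc hu0 hu0
    (φ := fun x y => L * ‖x - y‖ - K * ‖x - y‖ ^ 2) (by fun_prop) hnn hxy (by linarith)
  have hval := hmax x y hxy
  have hr0 : 0 < ‖x₀ - y₀‖ := by
    rw [norm_pos_iff, sub_ne_zero]
    rintro rfl
    simp only [sub_self, norm_zero] at hval
    linarith
  have hint : dist x₀ y₀ < L / (2 * K) := by
    refine lt_of_le_of_ne h₀ fun h => ?_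
    rw [dist_eq_norm] at h
    have h1 := abs_le.1 (hm x₀)
    have h2 := abs_le.1 (hm y₀)
    have h3 : L * (L / (2 * K)) - K * (L / (2 * K)) ^ 2 = 2 * m := by
      have : L * (L / (2 * K)) - K * (L / (2 * K)) ^ 2 = L ^ 2 / (4 * K) := by field_simp; ring
      rw [this, hLK]; field_simp; ring
    rw [h, h3] at hval
    linarith [h1.2, h2.1]
  have hnear : ∀ᶠ h : En n × En n in 𝓝 0, dist (x₀ + h.1) (y₀ + h.2) < L / (2 * K) := by
    have : ContinuousAt (fun h : En n × En n => dist (x₀ + h.1) (y₀ + h.2)) 0 := by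
      fun_prop
    exact this.eventually_lt continuousAt_const (by simpa using hint)
  have hLam0 : 0 < Lam := hlam.trans_le hLam
  set κ := 1 + 3 * lam + 2 * (n * Lam) with hκ
  have hκ0 : 0 < κ := by positivity
  have hkey := le_of_local_max_norm hlam hLam hF hv huc hu hL hK.le hr0 (x₀ := x₀) (y₀ := y₀)
    (e := ‖x₀ - y₀‖⁻¹ • (x₀ - y₀)) (by rw [norm_smul, norm_inv, norm_norm]; field_simp)
    (by rw [smul_smul, mul_inv_cancel₀ hr0.ne', one_smul])
    (hnear.mono fun h hh => hmax _ _ hh.le)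
    (η := (8 * lam * K - V - 2 * m) / (2 * κ)) (div_pos (by linarith) (by positivity))
  have h1 : (8 * lam * K - V - 2 * m) / (2 * κ) * κ = (8 * lam * K - V - 2 * m) / 2 := by
    field_simp
  rw [← hκ, h1] at hkey
  have h2 : L * ‖x₀ - y₀‖ / 2 ≤ 2 * m := by
    rw [dist_eq_norm] at hint
    have h3 : L * (L / (2 * K)) / 2 = 2 * m := by
      have : L * (L / (2 * K)) / 2 = L ^ 2 / (4 * K) := by field_simp; ring
      rw [this, hLK]; field_simp; ring
    have := mul_le_mul_of_nonneg_left hint.le hL.le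
    linarith
  have h4 := hV x₀ y₀
  linarith

end IshiiLions

section Compactness

theorem exists_subseq_tendsto_of_lipschitz {E : Type*} [PseudoMetricSpace E] [ProperSpace E]
    {f : ℕ → E → ℝ} {m M : ℝ} (hm : ∀ k x, |f k x| ≤ m)
    (hM : ∀ k x y, |f k x - f k y| ≤ M * dist x y) :
    ∃ g : ℕ → ℕ, StrictMono g ∧ ∃ U : E → ℝ, Continuous U ∧
      ∀ K : Set E, IsCompact K → TendstoUniformlyOn (fun k => f (g k)) U atTop K := by
  have hcont : ∀ h : E → ℝ, (∀ x y, |h x - h y| ≤ M * dist x y) → Continuous h := fun h hh =>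
    (LipschitzWith.of_dist_le_mul (K := M.toNNReal) fun x y => by
      rw [Real.dist_eq]
      exact (hh x y).trans
        (mul_le_mul_of_nonneg_right (Real.le_coe_toNNReal M) dist_nonneg)).continuous
  set S : Set C(E, ℝ) := {h | (∀ x, |h x| ≤ m) ∧ ∀ x y, |h x - h y| ≤ M * dist x y} with hS
  have himg : ContinuousMap.toFun '' S =
      {h : E → ℝ | (∀ x, |h x| ≤ m) ∧ ∀ x y, |h x - h y| ≤ M * dist x y} := by
    ext h
    constructor
    · rintro ⟨h', hh', rfl⟩
      exact hh'
    · intro hh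
      exact ⟨⟨h, hcont h hh.2⟩, hh, rfl⟩
  have hcpt : IsCompact (ContinuousMap.toFun '' S) := by
    rw [himg]
    refine (isCompact_univ_pi fun _ : E => isCompact_Icc (a := -m) (b := m)).of_isClosed_subset
      ?_ fun h hh x _ => abs_le.1 (hh.1 x)
    simp only [ofPred_and, ofPred_forall]
    refine (isClosed_iInter fun x => isClosed_le (by fun_prop) continuous_const).inter ?_
    exact isClosed_iInter fun x => isClosed_iInter fun y =>
      isClosed_le (by fun_prop) continuous_const
  have hequi : Equicontinuous ((↑) : S → E → ℝ) := by
    refine Metric.equicontinuous_of_continuity_modulus (fun t => M * t) ?_ _ ?_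
    · have : Continuous fun t : ℝ => M * t := by fun_prop
      simpa using this.tendsto 0
    · intro x y h
      exact h.2.2 x y
  have hScpt := ArzelaAscoli.isCompact_of_equicontinuous S hcpt hequi
  obtain ⟨U, -, g, hg, hlim⟩ := hScpt.isSeqCompact (x := fun k => ⟨f k, hcont _ (hM k)⟩)
    fun k => ⟨hm k, hM k⟩
  exact ⟨g, hg, U, U.continuous,
    ContinuousMap.tendsto_iff_forall_isCompact_tendstoUniformlyOn.1 hlim⟩

end Compactness

section WeightedSpace

variable {n : ℕ} {b : ℝ}

theorem normX_nonneg (u : En n → ℝ) : 0 ≤ normX n b u :=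
  Real.sSup_nonneg (by rintro _ ⟨y, rfl⟩; positivity)

theorem memX.abs_le {u : En n → ℝ} (hu : memX n b u) (y : En n) :
    |u y| ≤ normX n b u * (1 + ‖y‖ ^ 2) * Real.exp (-(b * ‖y‖ ^ 2)) := by
  have h := le_csSup hu.2 (mem_range_self y)
  rw [div_le_iff₀ (by positivity)] at h
  rw [Real.exp_neg, ← div_eq_mul_inv, le_div_iff₀ (Real.exp_pos _)]
  exact h

theorem weight_le_of_abs_le {u : En n → ℝ} {C : ℝ} {y : En n}
    (h : |u y| ≤ C * (1 + ‖y‖ ^ 2) * Real.exp (-(b * ‖y‖ ^ 2))) :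
    |u y| * Real.exp (b * ‖y‖ ^ 2) / (1 + ‖y‖ ^ 2) ≤ C := by
  rw [Real.exp_neg, ← div_eq_mul_inv, le_div_iff₀ (Real.exp_pos _)] at h
  rwa [div_le_iff₀ (by positivity)]

theorem normX_le {u : En n → ℝ} {C : ℝ}
    (h : ∀ y, |u y| ≤ C * (1 + ‖y‖ ^ 2) * Real.exp (-(b * ‖y‖ ^ 2))) : normX n b u ≤ C :=
  csSup_le (range_nonempty _) (by rintro _ ⟨y, rfl⟩; exact weight_le_of_abs_le (h y))

theorem memX_of_abs_le {u : En n → ℝ} {C : ℝ} (hu : Continuous u)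
    (h : ∀ y, |u y| ≤ C * (1 + ‖y‖ ^ 2) * Real.exp (-(b * ‖y‖ ^ 2))) : memX n b u :=
  ⟨hu, C, by rintro _ ⟨y, rfl⟩; exact weight_le_of_abs_le (h y)⟩

theorem memX.sub {u w : En n → ℝ} (hu : memX n b u) (hw : memX n b w) :
    memX n b fun y => u y - w y :=
  memX_of_abs_le (C := normX n b u + normX n b w) (hu.1.sub hw.1) fun y => by
    have h1 := hu.abs_le y
    have h2 := hw.abs_le y
    have h3 := abs_sub (u y) (w y)
    linarith

theorem abs_le_mul_gaussian {C t : ℝ} (hC : 0 ≤ C) {y : En n}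
    (h : t ≤ C * Real.exp (-(b * ‖y‖ ^ 2))) :
    t ≤ C * (1 + ‖y‖ ^ 2) * Real.exp (-(b * ‖y‖ ^ 2)) := by
  refine h.trans (mul_le_mul_of_nonneg_right ?_ (Real.exp_pos _).le)
  nlinarith [sq_nonneg ‖y‖]

theorem one_add_mul_exp_neg_le (hb : 0 < b) {s : ℝ} (hs : 0 ≤ s) :
    (1 + s) * Real.exp (-(b * s)) ≤ 1 + 1 / b := by
  have h1 := Real.add_one_le_exp (b * s)
  have h2 : 1 ≤ Real.exp (b * s) := Real.one_le_exp (by positivity)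
  rw [Real.exp_neg, ← div_eq_mul_inv, div_le_iff₀ (Real.exp_pos _)]
  have h3 : s ≤ 1 / b * Real.exp (b * s) := by
    rw [div_mul_eq_mul_div, one_mul, le_div_iff₀ hb]
    linarith
  linarith

theorem memX.abs_le_bound (hb : 0 < b) {u : En n → ℝ} (hu : memX n b u) (y : En n) :
    |u y| ≤ normX n b u * (1 + 1 / b) := by
  refine (hu.abs_le y).trans ?_
  rw [mul_assoc]
  exact mul_le_mul_of_nonneg_left (one_add_mul_exp_neg_le hb (sq_nonneg _)) (normX_nonneg u)

theorem memX.tendsto_zero (hb : 0 < b) {u : En n → ℝ} (hu : memX n b u) :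
    Tendsto u (cocompact (En n)) (𝓝 0) := by
  have h0 : Tendsto (fun s : ℝ => (1 + s) * Real.exp (-(b * s))) atTop (𝓝 0) := by
    have h1 : Tendsto (fun s : ℝ => s ^ (1 : ℝ) * Real.exp (-b * s)) atTop (𝓝 0) :=
      tendsto_rpow_mul_exp_neg_mul_atTop_nhds_zero 1 b hb
    have h2 : Tendsto (fun s : ℝ => s ^ (0 : ℝ) * Real.exp (-b * s)) atTop (𝓝 0) :=
      tendsto_rpow_mul_exp_neg_mul_atTop_nhds_zero 0 b hb
    have h3 := h2.add h1
    simp only [add_zero, Real.rpow_one, Real.rpow_zero] at h3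
    refine h3.congr fun s => ?_
    rw [neg_mul]
    ring
  have h1 : Tendsto (fun y : En n => ‖y‖ ^ 2) (cocompact (En n)) atTop :=
    (tendsto_pow_atTop two_ne_zero).comp tendsto_norm_cocompact_atTop
  have h2 := (h0.comp h1).const_mul (normX n b u)
  rw [mul_zero] at h2
  refine squeeze_zero_norm (fun y => ?_) h2
  rw [Real.norm_eq_abs, Function.comp_apply, ← mul_assoc]
  exact hu.abs_le y

theorem tendsto_normX_sub (hb : 0 < b) {f : ℕ → En n → ℝ} {U : En n → ℝ} {C : ℝ}
    (hC : ∀ k y, |f k y - U y| ≤ C * Real.exp (-(b * ‖y‖ ^ 2)))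
    (hf : ∀ K : Set (En n), IsCompact K → TendstoUniformlyOn f U atTop K) :
    Tendsto (fun k => normX n b fun y => f k y - U y) atTop (𝓝 0) := by
  rw [Metric.tendsto_nhds]
  intro ε hε
  obtain ⟨R, hR⟩ : ∃ R : ℝ, C ≤ ε / 2 * R ^ 2 ∧ 0 ≤ R := by
    refine ⟨Real.sqrt (|C| / (ε / 2)), ?_, Real.sqrt_nonneg _⟩
    rw [Real.sq_sqrt (by positivity), mul_div_cancel₀ _ (by positivity)]
    exact le_abs_self C
  have hδ : 0 < ε / 2 * Real.exp (-(b * R ^ 2)) := by positivity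
  filter_upwards [Metric.tendstoUniformlyOn_iff.1
    (hf _ (isCompact_closedBall (0 : En n) R)) _ hδ] with k hk
  have hle : normX n b (fun y => f k y - U y) ≤ ε / 2 := by
    refine normX_le fun y => ?_
    rcases le_total ‖y‖ R with hy | hy
    · have h := hk y (by simpa using hy)
      rw [dist_comm, Real.dist_eq] at h
      have he : Real.exp (-(b * R ^ 2)) ≤ Real.exp (-(b * ‖y‖ ^ 2)) := by gcongr
      exact abs_le_mul_gaussian (by positivity)
        (h.le.trans (mul_le_mul_of_nonneg_left he (by positivity)))
    · refine (hC k y).trans (mul_le_mul_of_nonneg_right ?_ (Real.exp_pos _).le)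
      have h2 : R ^ 2 ≤ ‖y‖ ^ 2 := by gcongr; exact hR.2
      nlinarith [hR.1]
  rw [Real.dist_eq, sub_zero, abs_of_nonneg (normX_nonneg _)]
  linarith

end WeightedSpace

section SolutionOperator

variable {n : ℕ} {lam Lam b : ℝ}

theorem abs_sub_le_gaussian_of_solution (hlam : 0 < lam) (hLam : lam ≤ Lam) {F : Mat n → ℝ}
    (hF : UniformlyElliptic n lam Lam F) (hb : 0 < b) (hbL : 8 * Lam * b ≤ 1)
    {v v' u w : En n → ℝ} (hv : memX n b v) (hv' : memX n b v') (hu : memX n b u)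
    (hw : memX n b w) (hus : ViscSolE n univ (Fop n F 0 v) u)
    (hws : ViscSolE n univ (Fop n F 0 v') w) {c C D : ℝ} (hc0 : 0 < c)
    (hc1 : c ≤ 2 * b * (n * lam)) (hc2 : c ≤ b / 2) (hD : 0 ≤ D) (hCD : D < C * c)
    (hvv : normX n b (fun y => v y - v' y) ≤ D) (z : En n) :
    |u z - w z| ≤ C * Real.exp (-(b * ‖z‖ ^ 2)) := by
  have hbd : ∀ y, |v y - v' y| ≤ D * (1 + ‖y‖ ^ 2) * Real.exp (-(b * ‖y‖ ^ 2)) := fun y =>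
    ((hv.sub hv').abs_le y).trans (by gcongr)
  rw [abs_le]
  have h1 := sub_le_gaussian hlam hLam hF hb hbL hv.1 hv'.1 hu.1 hw.1 (hv'.tendsto_zero hb)
    (hu.tendsto_zero hb) (hw.tendsto_zero hb) (hu.abs_le_bound hb) (hw.abs_le_bound hb)
    hus.1 hws.2 hc0 hc1 hc2 hD hCD (fun y => (le_abs_self _).trans (hbd y)) z
  have h2 := sub_le_gaussian hlam hLam hF hb hbL hv'.1 hv.1 hw.1 hu.1 (hv.tendsto_zero hb)
    (hw.tendsto_zero hb) (hu.tendsto_zero hb) (hw.abs_le_bound hb) (hu.abs_le_bound hb)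
    hws.1 hus.2 hc0 hc1 hc2 hD hCD (fun y => (by linarith [neg_abs_le (v y - v' y), hbd y])) z
  constructor <;> linarith

theorem exists_lipschitz_of_solution (hlam : 0 < lam) (hLam : lam ≤ Lam) {F : Mat n → ℝ}
    (hF : UniformlyElliptic n lam Lam F) {V m : ℝ} (hV : 0 ≤ V) (hm : 0 < m) :
    ∃ M : ℝ, ∀ v u : En n → ℝ, Continuous v → Continuous u →
      Tendsto u (cocompact (En n)) (𝓝 0) → ViscSolE n univ (Fop n F 0 v) u →
      (∀ x, |v x| ≤ V) → (∀ x, |u x| ≤ m) → ∀ x y, |u x - u y| ≤ M * dist x y := by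
  obtain ⟨K, hK, hVK⟩ : ∃ K : ℝ, 0 < K ∧ 2 * V + 2 * m < 8 * lam * K := by
    refine ⟨(2 * V + 2 * m) / lam, by positivity, ?_⟩
    have h : 8 * lam * ((2 * V + 2 * m) / lam) = 8 * (2 * V + 2 * m) := by field_simp
    rw [h]
    linarith
  set L : ℝ := Real.sqrt (8 * m * K)
  have hL : 0 < L := Real.sqrt_pos.2 (by positivity)
  have hLK : L ^ 2 = 8 * m * K := Real.sq_sqrt (by positivity)
  refine ⟨L + 2 * m / (L / (2 * K)), fun v u hv hu hu0 hus hvV hum => ?_⟩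
  have key : ∀ x y, u x - u y ≤ (L + 2 * m / (L / (2 * K))) * dist x y := by
    intro x y
    have hr : 0 < L / (2 * K) := by positivity
    have hd : 0 ≤ dist x y := dist_nonneg
    rw [add_mul]
    rcases le_total (dist x y) (L / (2 * K)) with hxy | hxy
    · have h := sub_le_of_solution hlam hLam hF hv hu hu0 hus (V := 2 * V)
        (fun x y => by linarith [abs_le.1 (hvV x), abs_le.1 (hvV y)]) hum hL hK hLK hVK hxy
      rw [← dist_eq_norm] at h
      have h1 : 0 ≤ 2 * m / (L / (2 * K)) * dist x y := by positivity
      have h2 : 0 ≤ K * dist x y ^ 2 := by positivity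
      linarith
    · have h1 : 2 * m ≤ 2 * m / (L / (2 * K)) * dist x y := by
        rw [div_mul_eq_mul_div, le_div_iff₀ hr]
        gcongr
      have h2 : 0 ≤ L * dist x y := by positivity
      linarith [abs_le.1 (hum x), abs_le.1 (hum y)]
  intro x y
  have h1 := key x y
  have h2 := key y x
  rw [dist_comm] at h2
  exact abs_le.2 ⟨by linarith, h1⟩

theorem exists_subseq_of_solutions (hlam : 0 < lam) (hLam : lam ≤ Lam) {F : Mat n → ℝ}
    (hF : UniformlyElliptic n lam Lam F) (hb : 0 < b) (hbL : 8 * Lam * b ≤ 1)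
    {v u : ℕ → En n → ℝ} {Cb : ℝ} (hv : ∀ k, memX n b (v k)) (hvC : ∀ k, normX n b (v k) ≤ Cb)
    (hu : ∀ k, memX n b (u k)) (hus : ∀ k, ViscSolE n univ (Fop n F 0 (v k)) (u k)) {c : ℝ}
    (hc0 : 0 < c) (hc1 : c ≤ 2 * b * (n * lam)) (hc2 : c ≤ b / 2) :
    ∃ g : ℕ → ℕ, StrictMono g ∧ ∃ U : En n → ℝ, memX n b U ∧
      Tendsto (fun k => normX n b fun y => u (g k) y - U y) atTop (𝓝 0) := by
  have hCb : 0 ≤ Cb := (normX_nonneg _).trans (hvC 0)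
  have hsub : ∀ k, normX n b (fun y => v k y - v 0 y) ≤ 2 * Cb := fun k => normX_le fun y => by
    have h1 := (hv k).abs_le y
    have h2 := (hv 0).abs_le y
    have h3 := abs_sub (v k y) (v 0 y)
    have h4 : 0 ≤ (1 + ‖y‖ ^ 2) * Real.exp (-(b * ‖y‖ ^ 2)) := by positivity
    nlinarith [hvC k, hvC 0]
  set C : ℝ := (2 * Cb + 1) / c
  have hC0 : 0 < C := by positivity
  have hCD : 2 * Cb < C * c := by
    have h : C * c = 2 * Cb + 1 := div_mul_cancel₀ _ hc0.ne'
    linarith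
  have hdiff : ∀ k y, |u k y - u 0 y| ≤ C * Real.exp (-(b * ‖y‖ ^ 2)) := fun k =>
    abs_sub_le_gaussian_of_solution hlam hLam hF hb hbL (hv k) (hv 0) (hu k) (hu 0) (hus k)
      (hus 0) hc0 hc1 hc2 (by positivity) hCD (hsub k)
  have hum : ∀ k y, |u k y| ≤ C + normX n b (u 0) * (1 + 1 / b) := by
    intro k y
    have h1 : Real.exp (-(b * ‖y‖ ^ 2)) ≤ 1 := Real.exp_le_one_iff.2 (by
      have : 0 ≤ b * ‖y‖ ^ 2 := by positivity
      linarith)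
    have h2 := (hu 0).abs_le_bound hb y
    have h3 := hdiff k y
    have h4 : |u k y| ≤ |u k y - u 0 y| + |u 0 y| := by
      simpa using abs_add_le (u k y - u 0 y) (u 0 y)
    nlinarith
  have hnn := normX_nonneg (b := b) (u 0)
  obtain ⟨M, hM⟩ := exists_lipschitz_of_solution hlam hLam hF (n := n)
    (V := Cb * (1 + 1 / b)) (m := C + normX n b (u 0) * (1 + 1 / b)) (by positivity)
    (by positivity)
  obtain ⟨g, hg, U, hU, hlim⟩ := exists_subseq_tendsto_of_lipschitz hum fun k =>
    hM (v k) (u k) (hv k).1 (hu k).1 ((hu k).tendsto_zero hb) (hus k)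
      (fun x => ((hv k).abs_le_bound hb x).trans (by gcongr; exact hvC k)) (hum k)
  have hU0 : ∀ y, |U y - u 0 y| ≤ C * Real.exp (-(b * ‖y‖ ^ 2)) := fun y =>
    le_of_tendsto ((((hlim {y} isCompact_singleton).tendsto_at rfl).sub_const _).abs)
      (Eventually.of_forall fun k => hdiff (g k) y)
  have hUX : memX n b U := memX_of_abs_le (C := C + normX n b (u 0)) hU fun y => by
    have h1 := abs_le_mul_gaussian hC0.le (hU0 y)
    have h2 := (hu 0).abs_le y
    have h4 : |U y| ≤ |U y - u 0 y| + |u 0 y| := by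
      simpa using abs_add_le (U y - u 0 y) (u 0 y)
    linarith
  refine ⟨g, hg, U, hUX, tendsto_normX_sub hb (C := 2 * C) (fun k y => ?_) hlim⟩
  have h1 := abs_sub_le (u (g k) y) (u 0 y) (U y)
  rw [abs_sub_comm (u 0 y)] at h1
  linarith [hdiff (g k) y, hU0 y]

end SolutionOperator

/-- **Proposition 3.6.** The solution operator `A : X₊ → X₊` of `F(D²u) - (1/2)y·Du = v` is
continuous and compact with respect to the norm `‖·‖_X` (compactness stated sequentially:
images of bounded sets have compact closure). -/
theorem solution_operator_continuous_compact (n : ℕ) (hn : 1 ≤ n) (lam Lam : ℝ)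
    (hlam : 0 < lam) (hLam : lam ≤ Lam)
    (F : Mat n → ℝ) (hF : UniformlyElliptic n lam Lam F) (hFh : PositivelyHomogeneous n F)
    (A : (En n → ℝ) → En n → ℝ)
    (hA : ∀ v : En n → ℝ, memX n (1/(8*Lam)) v → (∀ y, 0 ≤ v y) →
      memX n (1/(8*Lam)) (A v) ∧ (∀ y, 0 ≤ A v y) ∧
      ViscSolE n Set.univ (Fop n F 0 v) (A v)) :
    (∀ v : En n → ℝ, memX n (1/(8*Lam)) v → (∀ y, 0 ≤ v y) →
      ∀ ε : ℝ, 0 < ε → ∃ δ : ℝ, 0 < δ ∧ ∀ w : En n → ℝ,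
        memX n (1/(8*Lam)) w → (∀ y, 0 ≤ w y) →
        normX n (1/(8*Lam)) (fun y => w y - v y) < δ →
        normX n (1/(8*Lam)) (fun y => A w y - A v y) < ε) ∧
    (∀ (Cb : ℝ) (v : ℕ → En n → ℝ),
      (∀ k, memX n (1/(8*Lam)) (v k) ∧ (∀ y, 0 ≤ v k y) ∧ normX n (1/(8*Lam)) (v k) ≤ Cb) →
      ∃ g : ℕ → ℕ, StrictMono g ∧ ∃ U : En n → ℝ, memX n (1/(8*Lam)) U ∧
        Tendsto (fun k => normX n (1/(8*Lam)) (fun y => A (v (g k)) y - U y))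
          atTop (nhds 0)) := by
  have hLam0 : 0 < Lam := hlam.trans_le hLam
  have hb : 0 < 1 / (8 * Lam) := by positivity
  have hbL : 8 * Lam * (1 / (8 * Lam)) ≤ 1 := (mul_one_div_cancel (by positivity)).le
  have hn0 : (0 : ℝ) < n := by exact_mod_cast hn
  generalize 1 / (8 * Lam) = b at *
  set c : ℝ := min (2 * b * (n * lam)) (b / 2)
  have hc0 : 0 < c := lt_min (by positivity) (by positivity)
  have hc1 : c ≤ 2 * b * (n * lam) := min_le_left _ _
  have hc2 : c ≤ b / 2 := min_le_right _ _
  refine ⟨fun v hv hv0 ε hε => ⟨ε / 2 * c, by positivity, fun w hw hw0 hwv => ?_⟩,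
    fun Cb v hv => ?_⟩
  · obtain ⟨hAv, -, hAvs⟩ := hA v hv hv0
    obtain ⟨hAw, -, hAws⟩ := hA w hw hw0
    have h : normX n b (fun y => A w y - A v y) ≤ ε / 2 := normX_le fun y =>
      abs_le_mul_gaussian (by positivity) (abs_sub_le_gaussian_of_solution hlam hLam hF hb hbL
        hw hv hAw hAv hAws hAvs hc0 hc1 hc2 (normX_nonneg _) hwv le_rfl y)
    linarith
  · have hAk := fun k => hA (v k) (hv k).1 (hv k).2.1
    exact exists_subseq_of_solutions hlam hLam hF hb hbL (v := v)
      (u := fun k => A (v k)) (Cb := Cb) (fun k => (hv k).1)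
      (fun k => (hv k).2.2) (fun k => (hAk k).1) (fun k => (hAk k).2.2) hc0 hc1 hc2
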